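/- (Boundary tangency principle for λ-translating solitons, graph form.) Let D ⊆ ℝ² be a nonempty connected open set and let p be a boundary point of D at which D satisfies an interior ball condition (there is an open ball B ⊆ D with p ∈ ∂B). Let λ₁, λ₂ ∈ ℝ with λ₂ ≤ λ₁, and suppose u₁ satisfies the λ₁-soliton graph equation on D and u₂ satisfies the λ₂-soliton graph equation on D, and that both u₁ and u₂ extend continuously differentiably to D ∪ {p}. If u₂(x) ≥ u₁(x) for every x ∈ D, u₁(p) = u₂(p), and ∇u₁(p) = ∇u₂(p), then u₁ = u₂ on all of D. -/

import Mathlib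

open MeasureTheory

noncomputable section

/-- The Euclidean plane. -/
abbrev E2 := EuclideanSpace ℝ (Fin 2)

/-- `W u x = √(1 + ‖∇u(x)‖²)`. -/
noncomputable def W (u : E2 → ℝ) (x : E2) : ℝ := Real.sqrt (1 + ‖gradient u x‖ ^ 2)

/-- The divergence of a vector field `X : ℝ² → ℝ²`: `div X = ∂₁X₁ + ∂₂X₂`. -/
noncomputable def div2 (X : E2 → E2) (x : E2) : ℝ :=
  ∑ i : Fin 2, fderiv ℝ X x (EuclideanSpace.single i 1) i

/-- `u` satisfies the λ-soliton graph equation on the open set `D`: `u` is C² on `D` and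
`div (∇u / W(u)) = 2λ + 1/W(u)` at every point of `D`. -/
def SatisfiesSolitonEq (lam : ℝ) (D : Set E2) (u : E2 → ℝ) : Prop :=
  ContDiffOn ℝ 2 u D ∧
    ∀ x ∈ D, div2 (fun y => (W u y)⁻¹ • gradient u y) x = 2 * lam + (W u x)⁻¹

end

open scoped InnerProductSpace

theorem sum_bilin_sub_smul {V ι : Type*} [NormedAddCommGroup V] [InnerProductSpace ℝ V] [Fintype ι]
    (b : OrthonormalBasis ι ℝ V) (B : V →ₗ[ℝ] V →ₗ[ℝ] ℝ) (t : ℝ) {e : V} (he : ‖e‖ = 1) :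
    ∑ k, B (b k - (t * ⟪b k, e⟫_ℝ) • e) (b k - (t * ⟪b k, e⟫_ℝ) • e)
      = ∑ k, B (b k) (b k) + (t ^ 2 - 2 * t) * B e e := by
  have h1 : ∑ k, ⟪b k, e⟫_ℝ * B (b k) e = B e e := by
    calc _ = B (∑ k, ⟪b k, e⟫_ℝ • b k) e := by simp
      _ = _ := by rw [b.sum_repr']
  have h2 : ∑ k, ⟪b k, e⟫_ℝ * B e (b k) = B e e := by
    calc _ = B e (∑ k, ⟪b k, e⟫_ℝ • b k) := by simp
      _ = _ := by rw [b.sum_repr']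
  have h3 : ∑ k, ⟪b k, e⟫_ℝ * ⟪b k, e⟫_ℝ = 1 := by
    have := b.sum_inner_mul_inner e e
    rw [real_inner_self_eq_norm_sq, he] at this
    simpa [real_inner_comm] using this
  have : ∀ k, B (b k - (t * ⟪b k, e⟫_ℝ) • e) (b k - (t * ⟪b k, e⟫_ℝ) • e)
      = B (b k) (b k) - t * (⟪b k, e⟫_ℝ * B (b k) e) - t * (⟪b k, e⟫_ℝ * B e (b k))
        + t ^ 2 * B e e * (⟪b k, e⟫_ℝ * ⟪b k, e⟫_ℝ) := by
    intro k
    simp only [map_sub, map_smul, LinearMap.sub_apply, LinearMap.smul_apply, smul_eq_mul]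
    ring
  simp only [this, Finset.sum_add_distrib, Finset.sum_sub_distrib, ← Finset.mul_sum, h1, h2, h3]
  ring

theorem deriv2_nonneg_of_isLocalMin {f f' : ℝ → ℝ} {a f'' : ℝ} (hmin : IsLocalMin f a)
    (hf : ∀ᶠ t in nhds a, HasDerivAt f (f' t) t) (hf' : HasDerivAt f' f'' a) : 0 ≤ f'' := by
  by_contra! hneg
  have hd : deriv f =ᶠ[nhds a] f' := hf.mono fun t ht => ht.deriv
  have hdd : deriv (deriv f) a = f'' := by rw [hd.deriv_eq, hf'.deriv]
  have hmax : IsLocalMax f a :=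
    isLocalMax_of_deriv_deriv_neg (by rw [hdd]; exact hneg) hmin.deriv_eq_zero
      hf.self_of_nhds.continuousAt
  have hconst : f =ᶠ[nhds a] fun _ => f a := by
    filter_upwards [hmin, hmax] with t h1 h2 using le_antisymm h2 h1
  have : deriv f =ᶠ[nhds a] fun _ => 0 := by
    filter_upwards [hconst.eventuallyEq_nhds] with t ht
    rw [ht.deriv_eq]; simp
  rw [this.deriv_eq] at hdd
  simp at hdd
  linarith

theorem trace_comparison {V ι : Type*} [NormedAddCommGroup V] [InnerProductSpace ℝ V] [Fintype ι]
    (b : OrthonormalBasis ι ℝ V) (B₁ B₂ : V →ₗ[ℝ] V →ₗ[ℝ] ℝ) {N₁ N₂ M e : V}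
    (hN : ‖N₁‖ = 1) (hM : ‖M‖ = 1) (he : ‖e‖ = 1) (hN₂ : N₂ = (2 * ⟪M, e⟫_ℝ) • e - M)
    (H : ∀ τ₁ τ₂ : V, ⟪N₁, τ₁⟫_ℝ = 0 → ⟪N₂, τ₂⟫_ℝ = 0 →
      0 ≤ 2 * ‖τ₁ - (τ₂ - (2 * ⟪τ₂, e⟫_ℝ) • e)‖ ^ 2 + B₂ τ₂ τ₂ - B₁ τ₁ τ₁) :
    0 ≤ 4 * ‖N₁ - M‖ ^ 2 + (∑ k, B₂ (b k) (b k) - B₂ N₂ N₂)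
      - (∑ k, B₁ (b k) (b k) - B₁ N₁ N₁) := by
  have hee : ⟪e, e⟫_ℝ = 1 := by rw [real_inner_self_eq_norm_sq, he]; norm_num
  have hNN : ⟪N₁, N₁⟫_ℝ = 1 := by rw [real_inner_self_eq_norm_sq, hN]; norm_num
  have hMM : ⟪M, M⟫_ℝ = 1 := by rw [real_inner_self_eq_norm_sq, hM]; norm_num
  let R : V →ₗ[ℝ] V := LinearMap.id - 2 • ((innerₛₗ ℝ e).smulRight e)
  have hR : ∀ x, R x = x - (2 * ⟪x, e⟫_ℝ) • e := by
    intro x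
    simp [R, real_inner_comm, mul_smul, two_smul]
  have hRN : R M = -N₂ := by rw [hR, hN₂]; abel
  let τ : ι → V := fun k => b k - (1 * ⟪b k, N₁⟫_ℝ) • N₁
  let σ : ι → V := fun k => b k - (1 * ⟪b k, M⟫_ℝ) • M
  have hk : ∀ k, 0 ≤ 2 * ‖τ k - σ k‖ ^ 2 + B₂ (R (σ k)) (R (σ k)) - B₁ (τ k) (τ k) := by
    intro k
    have := H (τ k) (R (σ k)) ?_ ?_
    · convert this using 6
      rw [hR]
      simp only [inner_sub_left, inner_smul_left, hee]
      simp
      module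
    · simp only [τ, inner_sub_right, inner_smul_right, hNN]
      rw [real_inner_comm]; ring
    · rw [hR, hN₂]
      simp only [σ, inner_sub_right, inner_sub_left, inner_smul_right, inner_smul_left, hee, hMM,
        real_inner_comm M e, real_inner_comm (b k) e, real_inner_comm (b k) M]
      simp
      ring
  have hsum := Finset.sum_nonneg fun k (_ : k ∈ Finset.univ) => hk k
  rw [Finset.sum_sub_distrib, Finset.sum_add_distrib, ← Finset.mul_sum,
    sum_bilin_sub_smul b B₁ 1 hN] at hsum
  have h2 : ∑ k, B₂ (R (σ k)) (R (σ k)) = ∑ k, B₂ (b k) (b k) - B₂ N₂ N₂ := by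
    have h3 := sum_bilin_sub_smul b (B₂.compl₁₂ R R) 1 hM
    simp only [LinearMap.compl₁₂_apply, hRN] at h3
    simp only [σ]
    rw [h3]
    simp only [hR, sum_bilin_sub_smul b B₂ 2 he]
    simp
    ring
  have h4 : ∑ k, ‖τ k - σ k‖ ^ 2 ≤ 2 * ‖N₁ - M‖ ^ 2 := by
    have : ∀ k, ‖τ k - σ k‖ ^ 2 = ⟪N₁, b k⟫_ℝ * ⟪b k, N₁⟫_ℝ + ⟪M, b k⟫_ℝ * ⟪b k, M⟫_ℝ
        - 2 * ⟪N₁, M⟫_ℝ * (⟪N₁, b k⟫_ℝ * ⟪b k, M⟫_ℝ) := by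
      intro k
      rw [← real_inner_self_eq_norm_sq]
      simp only [τ, σ, inner_sub_right, inner_sub_left, inner_smul_right, inner_smul_left, hNN, hMM,
        real_inner_comm (b k) N₁, real_inner_comm (b k) M, real_inner_comm N₁ M]
      simp
      ring
    simp only [this, Finset.sum_add_distrib, Finset.sum_sub_distrib, ← Finset.mul_sum,
      b.sum_inner_mul_inner, hNN, hMM]
    rw [← real_inner_self_eq_norm_sq (N₁ - M)]
    simp only [inner_sub_right, inner_sub_left, hNN, hMM, real_inner_comm N₁ M]
    nlinarith [sq_nonneg (⟪N₁, M⟫_ℝ - 1)]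
  rw [h2] at hsum
  linarith

theorem differentiableAt_gradient {u : E2 → ℝ} {x : E2} (h : ContDiffAt ℝ 2 u x) :
    DifferentiableAt ℝ (gradient u) x := by
  have h1 : ContDiffAt ℝ 1 (fderiv ℝ u) x := h.fderiv_right (by norm_num)
  have h2 := h1.differentiableAt (by norm_num)
  exact ((InnerProductSpace.toDual ℝ E2).symm.toContinuousLinearEquiv.toContinuousLinearMap
    |>.differentiableAt).comp x h2

theorem W_pos (u : E2 → ℝ) (x : E2) : 0 < W u x := by
  unfold W; positivity

theorem W_sq (u : E2 → ℝ) (x : E2) : W u x ^ 2 = 1 + ‖gradient u x‖ ^ 2 := by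
  unfold W; exact Real.sq_sqrt (by positivity)

/-- The soliton graph equation in nondivergence form. -/
theorem SatisfiesSolitonEq.trace_eq {lam : ℝ} {D : Set E2} {u : E2 → ℝ}
    (h : SatisfiesSolitonEq lam D u) (hD : IsOpen D) {x : E2} (hx : x ∈ D) :
    ∑ i : Fin 2, fderiv ℝ (gradient u) x (EuclideanSpace.single i 1) i
      - ⟪fderiv ℝ (gradient u) x (gradient u x), gradient u x⟫_ℝ / W u x ^ 2
      = 2 * lam * W u x + 1 := by
  have hG : HasFDerivAt (gradient u) (fderiv ℝ (gradient u) x) x :=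
    (differentiableAt_gradient (h.1.contDiffAt (hD.mem_nhds hx))).hasFDerivAt
  have heq := h.2 x hx
  set A := fderiv ℝ (gradient u) x
  have hw := W_pos u x
  have hsq : HasFDerivAt (fun y => 1 + ‖gradient u y‖ ^ 2) (2 • (innerSL ℝ (gradient u x)).comp A) x :=
    (hG.norm_sq).const_add 1
  have hW : HasFDerivAt (W u) _ x := hsq.sqrt (by positivity)
  have hWi := (hasDerivAt_inv hw.ne').comp_hasFDerivAt x hW
  have hF := hWi.smul hG
  have hF' : fderiv ℝ (fun y => (W u y)⁻¹ • gradient u y) x = _ := hF.fderiv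
  rw [div2, hF'] at heq
  have hin : ⟪A (gradient u x), gradient u x⟫_ℝ
      = ∑ i : Fin 2, gradient u x i * ⟪gradient u x, A (EuclideanSpace.single i 1)⟫_ℝ := by
    have : gradient u x = ∑ i : Fin 2, gradient u x i • EuclideanSpace.single i (1 : ℝ) := by
      ext j; fin_cases j <;> simp
    conv_lhs => enter [2, 2]; rw [this]
    simp only [map_sum, map_smul, sum_inner, inner_smul_left, real_inner_comm]
    simp
  rw [hin]
  simp [Fin.sum_univ_two] at heq ⊢
  rw [show √(1 + ‖gradient u x‖ ^ 2) = W u x from rfl] at heq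
  field_simp at heq ⊢
  linarith

theorem mul_le_quarter_of_sq_eq {c s t d : ℝ} (hc : 0 < c) (hc' : c ≤ 1 / 32) (hs : 0 < s)
    (ht : 0 < t) (hd : 0 ≤ d) (hdsq : d ^ 2 = c * s * t) (hst : |t - s| ≤ 2 * d) :
    c * t ≤ d / 4 := by
  have h1 : (t - s) ^ 2 ≤ 4 * (c * s * t) := by
    rw [← hdsq, ← sq_abs]; nlinarith [abs_nonneg (t - s)]
  have hp : 0 < s * t := mul_pos hs ht
  have h2 : (t - s) ^ 2 ≤ s * t / 8 := by nlinarith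
  have h3 : t ≤ 2 * s := by
    by_contra! h
    nlinarith
  have h4 : c * t ≤ s / 16 := by nlinarith
  refine abs_le_of_sq_le_sq' ?_ (by positivity) |>.2
  have h5 : (c * t) * (c * t) ≤ (c * t) * (s / 16) := by gcongr
  nlinarith

theorem norm_normalize_sub_le {V : Type*} [NormedAddCommGroup V] [InnerProductSpace ℝ V]
    {n m : V} (hn : n ≠ 0) (hm : m ≠ 0) :
    ‖‖n‖⁻¹ • n - ‖m‖⁻¹ • m‖ ≤ 2 * ‖n - m‖ / ‖n‖ := by
  have hn' : 0 < ‖n‖ := norm_pos_iff.2 hn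
  have hm' : 0 < ‖m‖ := norm_pos_iff.2 hm
  have h : ‖n‖⁻¹ • n - ‖m‖⁻¹ • m = ‖n‖⁻¹ • ((n - m) + ((‖m‖ - ‖n‖) * ‖m‖⁻¹) • m) := by
    have : ‖n‖⁻¹ * ((‖m‖ - ‖n‖) * ‖m‖⁻¹) = ‖n‖⁻¹ - ‖m‖⁻¹ := by field_simp
    rw [smul_add, smul_smul, this]
    module
  rw [h, norm_smul, norm_inv, norm_norm, inv_mul_eq_div]
  gcongr
  refine (norm_add_le _ _).trans ?_
  have : ‖((‖m‖ - ‖n‖) * ‖m‖⁻¹) • m‖ ≤ ‖n - m‖ := by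
    rw [norm_smul, norm_mul, norm_inv, norm_norm, mul_assoc, inv_mul_cancel₀ hm'.ne', mul_one,
      norm_sub_rev n m]
    exact abs_norm_sub_norm_le _ _
  linarith

theorem normalize_smul_of_pos {V : Type*} [NormedAddCommGroup V] [InnerProductSpace ℝ V]
    {r : ℝ} (hr : 0 < r) (v : V) : ‖r • v‖⁻¹ • r • v = ‖v‖⁻¹ • v := by
  rw [norm_smul, Real.norm_of_nonneg hr.le, smul_smul]
  congr 1
  field_simp

theorem norm_normal_sub_reflected_normal_le {V : Type*} [NormedAddCommGroup V]
    [InnerProductSpace ℝ V] {Y a b n₁ n₂ : V} {c s₁ s₂ h : ℝ} (hc : 0 < c) (hc' : c ≤ 1 / 32)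
    (hs₁ : 0 < s₁) (hs₂ : 0 < s₂) (hh : 0 ≤ h) (hY : ‖Y‖ ^ 2 = c * s₁ * s₂)
    (hs : s₂ - s₁ = ⟪a + b, Y⟫_ℝ / 2) (ha : ‖a‖ ≤ 2) (hb : ‖b‖ ≤ 2) (hab : ‖b - a‖ ≤ h * ‖Y‖)
    (hn₁ : n₁ = Y + (c / 2 * s₂) • a) (hn₂ : n₂ = Y - (c / 2 * s₁) • b) :
    3 / 4 * ‖Y‖ ≤ ‖n₁‖ ∧ 3 / 4 * ‖Y‖ ≤ ‖n₂‖ ∧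
      ‖‖n₁‖⁻¹ • n₁ - ‖n₂‖⁻¹ • ((2 * ⟪n₂, Y⟫_ℝ / ‖Y‖ ^ 2) • Y - n₂)‖ ≤ 8 / 3 * c * s₂ * h := by
  have hYpos : 0 < ‖Y‖ := by
    have : 0 < ‖Y‖ ^ 2 := by rw [hY]; positivity
    exact lt_of_le_of_ne (norm_nonneg _) fun h0 => by simp [← h0] at this
  have hab' : |⟪a + b, Y⟫_ℝ| ≤ 4 * ‖Y‖ := by
    refine (abs_real_inner_le_norm _ _).trans ?_
    gcongr
    linarith [norm_add_le a b]
  have habs : |s₂ - s₁| ≤ 2 * ‖Y‖ := by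
    rw [hs, abs_div, abs_two]; linarith
  have hcs₂ : c * s₂ ≤ ‖Y‖ / 4 := mul_le_quarter_of_sq_eq hc hc' hs₁ hs₂ hYpos.le hY habs
  have hcs₁ : c * s₁ ≤ ‖Y‖ / 4 := mul_le_quarter_of_sq_eq hc hc' hs₂ hs₁ hYpos.le
    (by rw [hY]; ring) (by rwa [abs_sub_comm])
  have h1 : 3 / 4 * ‖Y‖ ≤ ‖n₁‖ := by
    have h2 : ‖(c / 2 * s₂) • a‖ ≤ ‖Y‖ / 4 := by
      rw [norm_smul, Real.norm_of_nonneg (by positivity)]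
      nlinarith [mul_pos hc hs₂]
    have h3 := norm_sub_norm_le Y (-((c / 2 * s₂) • a))
    rw [sub_neg_eq_add, ← hn₁, norm_neg] at h3
    linarith
  have h2 : 3 / 4 * ‖Y‖ ≤ ‖n₂‖ := by
    have h2 : ‖(c / 2 * s₁) • b‖ ≤ ‖Y‖ / 4 := by
      rw [norm_smul, Real.norm_of_nonneg (by positivity)]
      nlinarith [mul_pos hc hs₁]
    have h3 := norm_sub_norm_le Y ((c / 2 * s₁) • b)
    rw [← hn₂] at h3
    linarith
  refine ⟨h1, h2, ?_⟩
  set m := (2 * ⟪n₂, Y⟫_ℝ / ‖Y‖ ^ 2) • Y - n₂ with hm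
  have hmn : ‖m‖ = ‖n₂‖ := by
    have : ‖m‖ ^ 2 = ‖n₂‖ ^ 2 := by
      rw [hm, norm_sub_sq_real, norm_smul, inner_smul_left, mul_pow, Real.norm_eq_abs, sq_abs,
        real_inner_comm n₂ Y]
      simp
      field_simp
      ring
    exact (sq_eq_sq₀ (norm_nonneg _) (norm_nonneg _)).1 this
  have hn₁0 : n₁ ≠ 0 := norm_pos_iff.1 (by linarith)
  have hm0 : m ≠ 0 := norm_pos_iff.1 (by linarith)
  have hdiff : s₁ • n₁ - s₂ • m = (⟪b - a, Y⟫_ℝ / 2) • Y - (c / 2 * s₁ * s₂) • (b - a) := by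
    have hco : s₂ * (2 * ⟪n₂, Y⟫_ℝ / ‖Y‖ ^ 2) = 2 * s₂ - ⟪b, Y⟫_ℝ := by
      rw [hn₂, inner_sub_left, inner_smul_left, real_inner_self_eq_norm_sq, hY]
      simp
      field_simp
    have hco2 : ⟪b - a, Y⟫_ℝ / 2 = s₁ - s₂ + ⟪b, Y⟫_ℝ := by
      rw [inner_add_left] at hs
      rw [inner_sub_left]; linarith
    rw [hm, smul_sub, smul_smul, hco, hco2, hn₁, hn₂]
    module
  have hbound : ‖s₁ • n₁ - s₂ • m‖ ≤ c * s₁ * s₂ * h * ‖Y‖ := by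
    rw [hdiff]
    refine (norm_sub_le _ _).trans ?_
    rw [norm_smul, norm_smul, Real.norm_of_nonneg (by positivity : 0 ≤ c / 2 * s₁ * s₂),
      Real.norm_eq_abs, abs_div, abs_two]
    have h5 : |⟪b - a, Y⟫_ℝ| ≤ h * (c * s₁ * s₂) := by
      refine (abs_real_inner_le_norm _ _).trans ?_
      rw [← hY]
      nlinarith
    have h6 : c / 2 * s₁ * s₂ * ‖b - a‖ ≤ c / 2 * s₁ * s₂ * (h * ‖Y‖) := by gcongr
    nlinarith
  have h7 := norm_normalize_sub_le (smul_ne_zero hs₁.ne' hn₁0) (smul_ne_zero hs₂.ne' hm0)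
  rw [normalize_smul_of_pos hs₁, normalize_smul_of_pos hs₂, hmn] at h7
  refine h7.trans ?_
  rw [norm_smul, Real.norm_of_nonneg hs₁.le, div_le_iff₀ (mul_pos hs₁ (by linarith))]
  have h8 : 8 / 3 * c * s₂ * h * (s₁ * (3 / 4 * ‖Y‖)) ≤ 8 / 3 * c * s₂ * h * (s₁ * ‖n₁‖) := by
    gcongr
  linarith

/-- The vector of `ℝ² × ℝ` with horizontal part `v` and height `t`. -/
noncomputable def vec (v : E2) (t : ℝ) : WithLp 2 (E2 × ℝ) := WithLp.toLp 2 (v, t)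

theorem exists_eq_vec (τ : WithLp 2 (E2 × ℝ)) : ∃ v t, τ = vec v t := ⟨τ.fst, τ.snd, rfl⟩

theorem vec_add (v w : E2) (s t : ℝ) : vec v s + vec w t = vec (v + w) (s + t) := rfl

theorem vec_sub (v w : E2) (s t : ℝ) : vec v s - vec w t = vec (v - w) (s - t) := rfl

theorem smul_vec (r : ℝ) (v : E2) (s : ℝ) : r • vec v s = vec (r • v) (r * s) := rfl

theorem inner_vec (v w : E2) (s t : ℝ) : ⟪vec v s, vec w t⟫_ℝ = ⟪v, w⟫_ℝ + s * t := by
  simp [vec, WithLp.prod_inner_apply, mul_comm]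

theorem norm_vec_sq (v : E2) (s : ℝ) : ‖vec v s‖ ^ 2 = ‖v‖ ^ 2 + s ^ 2 := by
  simp [vec, WithLp.prod_norm_sq_eq_of_L2]

theorem norm_vec_zero (v : E2) : ‖vec v 0‖ = ‖v‖ :=
  (sq_eq_sq₀ (norm_nonneg _) (norm_nonneg _)).1 (by rw [norm_vec_sq]; ring)

/-- The quadratic form of an operator on the plane, as a bilinear form on `ℝ² × ℝ`. -/
noncomputable def horizontalForm (A : E2 →L[ℝ] E2) :
    WithLp 2 (E2 × ℝ) →ₗ[ℝ] WithLp 2 (E2 × ℝ) →ₗ[ℝ] ℝ :=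
  (innerₗ E2).compl₁₂ (A.toLinearMap ∘ₗ WithLp.fstₗ 2 ℝ E2 ℝ) (WithLp.fstₗ 2 ℝ E2 ℝ)

theorem horizontalForm_vec (A : E2 →L[ℝ] E2) (v w : E2) (s t : ℝ) :
    horizontalForm A (vec v s) (vec w t) = ⟪A v, w⟫_ℝ := rfl

/-- The standard orthonormal basis of `ℝ² × ℝ`. -/
noncomputable def stdBasis : OrthonormalBasis (Fin 2 ⊕ Fin 1) ℝ (WithLp 2 (E2 × ℝ)) :=
  (EuclideanSpace.basisFun (Fin 2) ℝ).prod (OrthonormalBasis.singleton (Fin 1) ℝ)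

theorem sum_horizontalForm (A : E2 →L[ℝ] E2) :
    ∑ k, horizontalForm A (stdBasis k) (stdBasis k)
      = ∑ i : Fin 2, A (EuclideanSpace.single i 1) i := by
  have h₁ : ∀ k, stdBasis (Sum.inl k) = vec (EuclideanSpace.single k 1) 0 := by
    intro k
    refine (OrthonormalBasis.prod_apply _ _ _).trans ?_
    simp [vec]
  have h₂ : ∀ k, stdBasis (Sum.inr k) = vec 0 1 := by
    intro k
    refine (OrthonormalBasis.prod_apply _ _ _).trans ?_
    exact congrArg (vec 0) (congrFun (OrthonormalBasis.coe_singleton (ι := Fin 1) (𝕜 := ℝ)) k)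
  simp [h₁, h₂, horizontalForm_vec, Fintype.sum_sum_type, EuclideanSpace.inner_single_right]

set_option maxHeartbeats 800000 in
theorem no_interior_contact {y G₁ G₂ a b : E2} {A₁ A₂ H : E2 →L[ℝ] E2}
    {z c s₁ s₂ h κ lam₁ lam₂ w₁ w₂ : ℝ} (hz : 0 < z) (hc : 0 < c) (hc' : c ≤ 1 / 32)
    (hh : 0 ≤ h) (hch : 64 * c * h ≤ 1) (hs₁ : 0 < s₁) (hs₂ : 0 < s₂) (hsh : s₂ * h ≤ 2)
    (hY : ‖y‖ ^ 2 + z ^ 2 = c * s₁ * s₂) (hab : b - a = H y)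
    (hs : s₂ - s₁ = ⟪a + b, y⟫_ℝ / 2) (ha : ‖a‖ ≤ 2) (hb : ‖b‖ ≤ 2)
    (hH : ∀ v, ‖H v‖ ≤ h * ‖v‖)
    (hG₁ : y + z • G₁ = -((c / 2 * s₂) • a)) (hG₂ : y + z • G₂ = (c / 2 * s₁) • b)
    (hw₁ : 0 < w₁) (hw₂ : 0 < w₂)
    (hw₁sq : w₁ ^ 2 = 1 + ‖G₁‖ ^ 2) (hw₂sq : w₂ ^ 2 = 1 + ‖G₂‖ ^ 2)
    (hA₁ : ∑ i : Fin 2, A₁ (EuclideanSpace.single i 1) i - ⟪A₁ G₁, G₁⟫_ℝ / w₁ ^ 2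
      = 2 * lam₁ * w₁ + 1)
    (hA₂ : ∑ i : Fin 2, A₂ (EuclideanSpace.single i 1) i - ⟪A₂ G₂, G₂⟫_ℝ / w₂ ^ 2
      = 2 * lam₂ * w₂ + 1)
    (hH₁ : κ ≤ ∑ i : Fin 2, H (EuclideanSpace.single i 1) i - ⟪H G₁, G₁⟫_ℝ / w₁ ^ 2)
    (hH₂ : κ ≤ ∑ i : Fin 2, H (EuclideanSpace.single i 1) i - ⟪H G₂, G₂⟫_ℝ / w₂ ^ 2)
    (hκ : 4 * |lam₁| + 2 ≤ κ) (hle : lam₂ ≤ lam₁)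
    (hsecond : ∀ ξ₁ ξ₂ : E2, 0 ≤ 2 * ‖ξ₂ - ξ₁‖ ^ 2 + 2 * (⟪G₂, ξ₂⟫_ℝ - ⟪G₁, ξ₁⟫_ℝ) ^ 2
      + 2 * z * (⟪A₂ ξ₂, ξ₂⟫_ℝ - ⟪A₁ ξ₁, ξ₁⟫_ℝ)
      - c * (s₂ * ⟪H ξ₁, ξ₁⟫_ℝ + s₁ * ⟪H ξ₂, ξ₂⟫_ℝ + 2 * ⟪a, ξ₁⟫_ℝ * ⟪b, ξ₂⟫_ℝ)) : False := by
  obtain ⟨Y, hYdef⟩ : ∃ Y, Y = vec y z := ⟨_, rfl⟩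
  obtain ⟨n₁, hn₁def⟩ : ∃ n, n = vec (-(z • G₁)) z := ⟨_, rfl⟩
  obtain ⟨n₂, hn₂def⟩ : ∃ n, n = vec (-(z • G₂)) z := ⟨_, rfl⟩
  have hYV : ‖Y‖ ^ 2 = c * s₁ * s₂ := by rw [hYdef, norm_vec_sq, hY]
  have hn₁ : n₁ = Y + (c / 2 * s₂) • vec a 0 := by
    have : -(z • G₁) = y + (c / 2 * s₂) • a := by
      rw [eq_neg_iff_add_eq_zero] at hG₁
      rw [neg_eq_iff_add_eq_zero, ← hG₁]; abel
    rw [hn₁def, hYdef, smul_vec, vec_add, this, mul_zero, add_zero]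
  have hn₂ : n₂ = Y - (c / 2 * s₁) • vec b 0 := by
    have : -(z • G₂) = y - (c / 2 * s₁) • b := by
      rw [← hG₂]; abel
    rw [hn₂def, hYdef, smul_vec, vec_sub, this, mul_zero, sub_zero]
  have hYpos : 0 < ‖Y‖ := by
    have : 0 < ‖Y‖ ^ 2 := by rw [hYV]; positivity
    exact lt_of_le_of_ne (norm_nonneg _) fun h0 => by simp [← h0] at this
  have hyY : ‖y‖ ≤ ‖Y‖ := by
    refine abs_le_of_sq_le_sq' ?_ hYpos.le |>.2
    rw [hYV, ← hY]; nlinarith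
  obtain ⟨hn₁Y, hn₂Y, hclose⟩ := norm_normal_sub_reflected_normal_le (a := vec a 0) (b := vec b 0)
    hc hc' hs₁ hs₂ hh hYV
    (by rw [hs, vec_add, hYdef, inner_vec]; simp)
    (by rwa [norm_vec_zero]) (by rwa [norm_vec_zero])
    (by
      rw [vec_sub, sub_zero, norm_vec_zero, hab]
      exact (hH y).trans (by gcongr)) hn₁ hn₂
  have hnw : ∀ {G : E2} {w : ℝ}, 0 < w → w ^ 2 = 1 + ‖G‖ ^ 2 → ‖vec (-(z • G)) z‖ = z * w := by
    intro G w hw hwsq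
    have : ‖vec (-(z • G)) z‖ ^ 2 = (z * w) ^ 2 := by
      rw [norm_vec_sq, norm_neg, norm_smul, mul_pow, mul_pow, hwsq, Real.norm_eq_abs, sq_abs]
      ring
    exact (sq_eq_sq₀ (norm_nonneg _) (by positivity)).1 this
  have hnorm₁ : ‖n₁‖ = z * w₁ := by rw [hn₁def, hnw hw₁ hw₁sq]
  have hnorm₂ : ‖n₂‖ = z * w₂ := by rw [hn₂def, hnw hw₂ hw₂sq]
  have hp₁ : 0 < ‖n₁‖ := by linarith
  have hp₂ : 0 < ‖n₂‖ := by linarith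
  set m := (2 * ⟪n₂, Y⟫_ℝ / ‖Y‖ ^ 2) • Y - n₂ with hm
  have hmn : ‖m‖ = ‖n₂‖ := by
    have : ‖m‖ ^ 2 = ‖n₂‖ ^ 2 := by
      rw [hm, norm_sub_sq_real, norm_smul, inner_smul_left, mul_pow, Real.norm_eq_abs, sq_abs,
        real_inner_comm n₂ Y]
      simp
      field_simp
      ring
    exact (sq_eq_sq₀ (norm_nonneg _) (norm_nonneg _)).1 this
  have hmY : ⟪m, Y⟫_ℝ = ⟪n₂, Y⟫_ℝ := by
    rw [hm, inner_sub_left, inner_smul_left, real_inner_self_eq_norm_sq]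
    simp
    field_simp
    ring
  have key := trace_comparison stdBasis
    ((2 * z) • horizontalForm A₁ + (c * s₂) • horizontalForm H)
    ((2 * z) • horizontalForm A₂ - (c * s₁) • horizontalForm H)
    (N₁ := ‖n₁‖⁻¹ • n₁) (N₂ := ‖n₂‖⁻¹ • n₂) (M := ‖n₂‖⁻¹ • m) (e := ‖Y‖⁻¹ • Y)
    (by rw [norm_smul, norm_inv, norm_norm, inv_mul_cancel₀ hp₁.ne'])
    (by rw [norm_smul, norm_inv, norm_norm, hmn, inv_mul_cancel₀ hp₂.ne'])
    (by rw [norm_smul, norm_inv, norm_norm, inv_mul_cancel₀ hYpos.ne'])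
    (by
      rw [inner_smul_left, inner_smul_right, hmY, hm, smul_sub, smul_smul, smul_smul]
      have : 2 * ((starRingEnd ℝ) ‖n₂‖⁻¹ * (‖Y‖⁻¹ * ⟪n₂, Y⟫_ℝ)) * ‖Y‖⁻¹
          = ‖n₂‖⁻¹ * (2 * ⟪n₂, Y⟫_ℝ / ‖Y‖ ^ 2) := by
        simp; field_simp
      rw [this]; abel)
    (by
      intro τ₁ τ₂ h₁ h₂
      rw [inner_smul_left] at h₁ h₂
      have h₁' : ⟪n₁, τ₁⟫_ℝ = 0 := by
        have := hp₁.ne'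
        simpa [this, norm_ne_zero_iff.1 this] using h₁
      have h₂' : ⟪n₂, τ₂⟫_ℝ = 0 := by
        have := hp₂.ne'
        simpa [this, norm_ne_zero_iff.1 this] using h₂
      have hexp : ‖τ₁ - (τ₂ - (2 * ⟪τ₂, ‖Y‖⁻¹ • Y⟫_ℝ) • ‖Y‖⁻¹ • Y)‖ ^ 2
          = ‖τ₁ - τ₂‖ ^ 2 + 4 * (⟪τ₁, Y⟫_ℝ * ⟪τ₂, Y⟫_ℝ) / ‖Y‖ ^ 2 := by
        have : τ₁ - (τ₂ - (2 * ⟪τ₂, ‖Y‖⁻¹ • Y⟫_ℝ) • ‖Y‖⁻¹ • Y)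
            = (τ₁ - τ₂) + (2 * ⟪τ₂, Y⟫_ℝ / ‖Y‖ ^ 2) • Y := by
          rw [inner_smul_right, smul_smul]
          have : 2 * (‖Y‖⁻¹ * ⟪τ₂, Y⟫_ℝ) * ‖Y‖⁻¹ = 2 * ⟪τ₂, Y⟫_ℝ / ‖Y‖ ^ 2 := by field_simp
          rw [this]; abel
        rw [this, norm_add_sq_real, inner_smul_right, inner_sub_left, norm_smul, mul_pow,
          Real.norm_eq_abs, sq_abs]
        field_simp
        ring
      rw [hexp, hYV]
      clear hexp h₁ h₂
      obtain ⟨ξ₁, t₁, rfl⟩ := exists_eq_vec τ₁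
      obtain ⟨ξ₂, t₂, rfl⟩ := exists_eq_vec τ₂
      have ht₁ : t₁ = ⟪G₁, ξ₁⟫_ℝ := by
        rw [hn₁def, inner_vec, inner_neg_left, real_inner_smul_left] at h₁'
        have : z * (t₁ - ⟪G₁, ξ₁⟫_ℝ) = 0 := by linarith
        linarith [(mul_eq_zero.1 this).resolve_left hz.ne']
      have ht₂ : t₂ = ⟪G₂, ξ₂⟫_ℝ := by
        rw [hn₂def, inner_vec, inner_neg_left, real_inner_smul_left] at h₂'
        have : z * (t₂ - ⟪G₂, ξ₂⟫_ℝ) = 0 := by linarith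
        linarith [(mul_eq_zero.1 this).resolve_left hz.ne']
      have hY₁ : ⟪vec ξ₁ t₁, Y⟫_ℝ = -(c / 2 * s₂) * ⟪a, ξ₁⟫_ℝ := by
        rw [hn₁, inner_add_left, real_inner_smul_left, inner_vec] at h₁'
        rw [real_inner_comm]; linarith
      have hY₂ : ⟪vec ξ₂ t₂, Y⟫_ℝ = c / 2 * s₁ * ⟪b, ξ₂⟫_ℝ := by
        rw [hn₂, inner_sub_left, real_inner_smul_left, inner_vec] at h₂'
        rw [real_inner_comm]; linarith
      have hab2 : 4 * (⟪vec ξ₁ t₁, Y⟫_ℝ * ⟪vec ξ₂ t₂, Y⟫_ℝ) / (c * s₁ * s₂)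
          = - c * (⟪a, ξ₁⟫_ℝ * ⟪b, ξ₂⟫_ℝ) := by
        rw [hY₁, hY₂]; field_simp; ring
      rw [hab2, vec_sub, norm_vec_sq, ht₁, ht₂, norm_sub_rev]
      have := hsecond ξ₁ ξ₂
      simp only [LinearMap.add_apply, LinearMap.sub_apply, LinearMap.smul_apply,
        horizontalForm_vec, smul_eq_mul]
      linarith)
  simp only [LinearMap.add_apply, LinearMap.sub_apply, LinearMap.smul_apply, smul_eq_mul,
    Finset.sum_add_distrib, Finset.sum_sub_distrib, ← Finset.mul_sum, sum_horizontalForm] at key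
  have hform : ∀ (A : E2 →L[ℝ] E2) (G : E2) {w : ℝ}, 0 < w →
      horizontalForm A ((z * w)⁻¹ • vec (-(z • G)) z) ((z * w)⁻¹ • vec (-(z • G)) z)
        = ⟪A G, G⟫_ℝ / w ^ 2 := by
    intro A G w hw
    rw [smul_vec, horizontalForm_vec]
    simp only [smul_neg, smul_smul, map_neg, map_smul, inner_neg_neg, real_inner_smul_left,
      real_inner_smul_right]
    field_simp
  have hN₁ : ‖n₁‖⁻¹ • n₁ = (z * w₁)⁻¹ • vec (-(z • G₁)) z := by rw [hnorm₁, hn₁def]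
  have hN₂ : ‖n₂‖⁻¹ • n₂ = (z * w₂)⁻¹ • vec (-(z • G₂)) z := by rw [hnorm₂, hn₂def]
  have hsq : 4 * ‖‖n₁‖⁻¹ • n₁ - ‖n₂‖⁻¹ • m‖ ^ 2 ≤ c * s₂ := by
    calc 4 * ‖‖n₁‖⁻¹ • n₁ - ‖n₂‖⁻¹ • m‖ ^ 2 ≤ 4 * (8 / 3 * c * s₂ * h) ^ 2 := by gcongr
      _ = 4 / 9 * (c * s₂) * ((64 * c * h) * (s₂ * h)) := by ring
      _ ≤ 4 / 9 * (c * s₂) * (1 * 2) := by gcongr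
      _ ≤ c * s₂ := by nlinarith [mul_pos hc hs₂]
  have hdiff : |z * w₂ - z * w₁| ≤ c * (s₁ + s₂) := by
    rw [← hnorm₁, ← hnorm₂]
    refine (abs_norm_sub_norm_le _ _).trans ?_
    have : n₂ - n₁ = -((c / 2 * s₁) • vec b 0 + (c / 2 * s₂) • vec a 0) := by
      rw [hn₁, hn₂]; abel
    rw [this, norm_neg]
    refine (norm_add_le _ _).trans ?_
    rw [norm_smul, norm_smul, norm_vec_zero, norm_vec_zero,
      Real.norm_of_nonneg (by positivity : 0 ≤ c / 2 * s₁),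
      Real.norm_of_nonneg (by positivity : 0 ≤ c / 2 * s₂)]
    have h1 : c / 2 * s₁ * ‖b‖ ≤ c / 2 * s₁ * 2 := by gcongr
    have h2 : c / 2 * s₂ * ‖a‖ ≤ c / 2 * s₂ * 2 := by gcongr
    linarith
  rw [hN₁, hN₂, hform _ _ hw₁, hform _ _ hw₁, hform _ _ hw₂, hform _ _ hw₂, ← hN₁] at key
  have e₁ : z * (∑ i : Fin 2, A₁ (EuclideanSpace.single i 1) i - ⟪A₁ G₁, G₁⟫_ℝ / w₁ ^ 2)
      = z * (2 * lam₁ * w₁ + 1) := by rw [hA₁]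
  have e₂ : z * (∑ i : Fin 2, A₂ (EuclideanSpace.single i 1) i - ⟪A₂ G₂, G₂⟫_ℝ / w₂ ^ 2)
      = z * (2 * lam₂ * w₂ + 1) := by rw [hA₂]
  have k₁ := mul_le_mul_of_nonneg_left hH₁ (mul_pos hc hs₂).le
  have k₂ := mul_le_mul_of_nonneg_left hH₂ (mul_pos hc hs₁).le
  have l₁ : lam₂ * (z * w₂) ≤ lam₁ * (z * w₂) := by gcongr
  have l₂ : lam₁ * (z * w₂ - z * w₁) ≤ |lam₁| * (c * (s₁ + s₂)) := by
    refine (le_abs_self _).trans ?_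
    rw [abs_mul]
    gcongr
  have l₃ : c * (s₁ + s₂) * (4 * |lam₁| + 2) ≤ c * (s₁ + s₂) * κ := by gcongr
  have l₄ : 0 < c * s₁ := mul_pos hc hs₁
  have l₅ : 0 < c * s₂ := mul_pos hc hs₂
  linarith

/-- The inhomogeneous quadratic polynomial with value `α`, gradient `ν` and Hessian `H` at `p`. -/
noncomputable def quad (α : ℝ) (ν : E2) (H : E2 →L[ℝ] E2) (p x : E2) : ℝ :=
  α + ⟪ν, x - p⟫_ℝ + ⟪H (x - p), x - p⟫_ℝ / 2

theorem quad_add {α : ℝ} {ν : E2} {H : E2 →L[ℝ] E2} {p : E2}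
    (hH : ∀ v w, ⟪H v, w⟫_ℝ = ⟪H w, v⟫_ℝ) (x v : E2) :
    quad α ν H p (x + v) = quad α ν H p x + ⟪ν + H (x - p), v⟫_ℝ + ⟪H v, v⟫_ℝ / 2 := by
  have h : x + v - p = (x - p) + v := by abel
  simp only [quad, h, map_add, inner_add_left, inner_add_right, hH v (x - p)]
  ring

theorem quad_sub_quad {α : ℝ} {ν : E2} {H : E2 →L[ℝ] E2} {p : E2}
    (hH : ∀ v w, ⟪H v, w⟫_ℝ = ⟪H w, v⟫_ℝ) (x x' : E2) :
    quad α ν H p x' - quad α ν H p x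
      = ⟪(ν + H (x - p)) + (ν + H (x' - p)), x' - x⟫_ℝ / 2 := by
  have h := quad_add (α := α) (ν := ν) (p := p) hH x (x' - x)
  have h' : H (x' - p) = H (x - p) + H (x' - x) := by rw [← map_add]; congr 1; abel
  rw [add_sub_cancel] at h
  rw [h, h']
  simp only [inner_add_left]
  ring

theorem hasDerivAt_quad_line {α : ℝ} {ν : E2} {H : E2 →L[ℝ] E2} {p : E2}
    (hH : ∀ v w, ⟪H v, w⟫_ℝ = ⟪H w, v⟫_ℝ) (x v : E2) (t : ℝ) :
    HasDerivAt (fun t : ℝ => quad α ν H p (x + t • v))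
      (⟪ν + H (x - p), v⟫_ℝ + t * ⟪H v, v⟫_ℝ) t := by
  have h : (fun t : ℝ => quad α ν H p (x + t • v)) = fun t => quad α ν H p x
      + t * ⟪ν + H (x - p), v⟫_ℝ + t ^ 2 * (⟪H v, v⟫_ℝ / 2) := by
    funext t
    rw [quad_add hH, map_smul, real_inner_smul_left, real_inner_smul_right, real_inner_smul_right]
    ring
  rw [h]
  have := (((hasDerivAt_id t).mul_const ⟪ν + H (x - p), v⟫_ℝ).const_add (quad α ν H p x)).add
    ((hasDerivAt_pow 2 t).mul_const (⟪H v, v⟫_ℝ / 2))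
  refine this.congr_deriv ?_
  simp
  ring

theorem hasDerivAt_line {u : E2 → ℝ} {x v : E2} {t : ℝ}
    (h : DifferentiableAt ℝ u (x + t • v)) :
    HasDerivAt (fun t : ℝ => u (x + t • v)) ⟪gradient u (x + t • v), v⟫_ℝ t := by
  have h1 : HasDerivAt (fun t : ℝ => x + t • v) v t := by
    simpa using ((hasDerivAt_id t).smul_const v).const_add x
  have := h.hasGradientAt.hasFDerivAt.comp_hasDerivAt t h1
  exact this.congr_deriv (by simp)

theorem contact_conditions {u₁ u₂ : E2 → ℝ} {x₁ x₂ ν p : E2} {α c : ℝ} {H : E2 →L[ℝ] E2}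
    (hH : ∀ v w, ⟪H v, w⟫_ℝ = ⟪H w, v⟫_ℝ)
    (h₁ : ContDiffAt ℝ 2 u₁ x₁) (h₂ : ContDiffAt ℝ 2 u₂ x₂)
    (hmin : IsLocalMin (fun q : E2 × E2 => ‖q.2 - q.1‖ ^ 2 + (u₂ q.2 - u₁ q.1) ^ 2
      - c * (quad α ν H p q.1 * quad α ν H p q.2)) (x₁, x₂)) :
    x₂ - x₁ + (u₂ x₂ - u₁ x₁) • gradient u₁ x₁
        = -((c / 2 * quad α ν H p x₂) • (ν + H (x₁ - p))) ∧
    x₂ - x₁ + (u₂ x₂ - u₁ x₁) • gradient u₂ x₂ = (c / 2 * quad α ν H p x₁) • (ν + H (x₂ - p)) ∧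
    ∀ ξ₁ ξ₂ : E2, 0 ≤ 2 * ‖ξ₂ - ξ₁‖ ^ 2
      + 2 * (⟪gradient u₂ x₂, ξ₂⟫_ℝ - ⟪gradient u₁ x₁, ξ₁⟫_ℝ) ^ 2
      + 2 * (u₂ x₂ - u₁ x₁) * (⟪fderiv ℝ (gradient u₂) x₂ ξ₂, ξ₂⟫_ℝ
        - ⟪fderiv ℝ (gradient u₁) x₁ ξ₁, ξ₁⟫_ℝ)
      - c * (quad α ν H p x₂ * ⟪H ξ₁, ξ₁⟫_ℝ + quad α ν H p x₁ * ⟪H ξ₂, ξ₂⟫_ℝ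
        + 2 * ⟪ν + H (x₁ - p), ξ₁⟫_ℝ * ⟪ν + H (x₂ - p), ξ₂⟫_ℝ) := by
  let f (ξ₁ ξ₂ : E2) (t : ℝ) : ℝ := ‖(x₂ + t • ξ₂) - (x₁ + t • ξ₁)‖ ^ 2
    + (u₂ (x₂ + t • ξ₂) - u₁ (x₁ + t • ξ₁)) ^ 2
    - c * (quad α ν H p (x₁ + t • ξ₁) * quad α ν H p (x₂ + t • ξ₂))
  let f' (ξ₁ ξ₂ : E2) (t : ℝ) : ℝ := 2 * (⟪x₂ - x₁, ξ₂ - ξ₁⟫_ℝ + t * ‖ξ₂ - ξ₁‖ ^ 2)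
    + 2 * ((u₂ (x₂ + t • ξ₂) - u₁ (x₁ + t • ξ₁))
      * (⟪gradient u₂ (x₂ + t • ξ₂), ξ₂⟫_ℝ - ⟪gradient u₁ (x₁ + t • ξ₁), ξ₁⟫_ℝ))
    - c * ((⟪ν + H (x₁ - p), ξ₁⟫_ℝ + t * ⟪H ξ₁, ξ₁⟫_ℝ) * quad α ν H p (x₂ + t • ξ₂)
      + quad α ν H p (x₁ + t • ξ₁) * (⟪ν + H (x₂ - p), ξ₂⟫_ℝ + t * ⟪H ξ₂, ξ₂⟫_ℝ))
  have hline : ∀ x v : E2, Filter.Tendsto (fun t : ℝ => x + t • v) (nhds 0) (nhds x) := by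
    intro x v
    have : ContinuousAt (fun t : ℝ => x + t • v) 0 := by fun_prop
    simpa [ContinuousAt] using this
  have hlm : ∀ ξ₁ ξ₂, IsLocalMin (f ξ₁ ξ₂) 0 := by
    intro ξ₁ ξ₂
    have := ((hline x₁ ξ₁).prodMk_nhds (hline x₂ ξ₂)).eventually hmin
    filter_upwards [this] with t ht
    simpa [f] using ht
  have hsqd : ∀ (ξ₁ ξ₂ : E2) (t : ℝ), HasDerivAt
      (fun t : ℝ => ‖(x₂ + t • ξ₂) - (x₁ + t • ξ₁)‖ ^ 2)
      (2 * (⟪x₂ - x₁, ξ₂ - ξ₁⟫_ℝ + t * ‖ξ₂ - ξ₁‖ ^ 2)) t := by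
    intro ξ₁ ξ₂ t
    have h : (fun t : ℝ => ‖(x₂ + t • ξ₂) - (x₁ + t • ξ₁)‖ ^ 2)
        = fun t => ‖x₂ - x₁‖ ^ 2 + t * (2 * ⟪x₂ - x₁, ξ₂ - ξ₁⟫_ℝ) + t ^ 2 * ‖ξ₂ - ξ₁‖ ^ 2 := by
      funext t
      have : (x₂ + t • ξ₂) - (x₁ + t • ξ₁) = (x₂ - x₁) + t • (ξ₂ - ξ₁) := by module
      rw [this, norm_add_sq_real, real_inner_smul_right, norm_smul, mul_pow, Real.norm_eq_abs,
        sq_abs]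
      ring
    rw [h]
    have := (((hasDerivAt_id t).mul_const (2 * ⟪x₂ - x₁, ξ₂ - ξ₁⟫_ℝ)).const_add
      (‖x₂ - x₁‖ ^ 2)).add ((hasDerivAt_pow 2 t).mul_const (‖ξ₂ - ξ₁‖ ^ 2))
    refine this.congr_deriv ?_
    simp
    ring
  have hd : ∀ ξ₁ ξ₂ (t : ℝ), DifferentiableAt ℝ u₁ (x₁ + t • ξ₁) →
      DifferentiableAt ℝ u₂ (x₂ + t • ξ₂) → HasDerivAt (f ξ₁ ξ₂) (f' ξ₁ ξ₂ t) t := by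
    intro ξ₁ ξ₂ t d₁ d₂
    have := ((hsqd ξ₁ ξ₂ t).add (((hasDerivAt_line d₂).sub (hasDerivAt_line d₁)).pow 2)).sub
      (((hasDerivAt_quad_line (α := α) (ν := ν) (p := p) hH x₁ ξ₁ t).mul
        (hasDerivAt_quad_line (α := α) (ν := ν) (p := p) hH x₂ ξ₂ t)).const_mul c)
    refine this.congr_deriv ?_
    simp [f']
    ring
  have hev : ∀ {u : E2 → ℝ} {x : E2} (ξ : E2), ContDiffAt ℝ 2 u x →
      ∀ᶠ t : ℝ in nhds 0, DifferentiableAt ℝ u (x + t • ξ) := by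
    intro u x ξ h
    have h1 : ∀ᶠ y in nhds x, ContDiffAt ℝ 2 u y := h.eventually (by simp)
    exact ((hline x ξ).eventually h1).mono fun t ht => ht.differentiableAt (by norm_num)
  have hzero : ∀ ξ₁ ξ₂, f' ξ₁ ξ₂ 0 = 0 := fun ξ₁ ξ₂ =>
    (hlm ξ₁ ξ₂).hasDerivAt_eq_zero
      (hd ξ₁ ξ₂ 0 (hev ξ₁ h₁).self_of_nhds (hev ξ₂ h₂).self_of_nhds)
  refine ⟨?_, ?_, fun ξ₁ ξ₂ => ?_⟩
  · refine ext_inner_right ℝ fun v => ?_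
    have := hzero v 0
    simp only [f', smul_zero, add_zero, zero_smul, zero_mul, map_zero, inner_zero_right, zero_sub,
      mul_zero, inner_neg_right] at this
    rw [inner_add_left, real_inner_smul_left, inner_neg_left, real_inner_smul_left]
    linarith
  · refine ext_inner_right ℝ fun v => ?_
    have := hzero 0 v
    simp only [f', smul_zero, add_zero, zero_smul, zero_mul, map_zero, inner_zero_right, sub_zero,
      mul_zero, zero_add] at this
    rw [inner_add_left, real_inner_smul_left, real_inner_smul_left]
    linarith
  · have hgr : ∀ {u : E2 → ℝ} {x : E2} (ξ : E2), ContDiffAt ℝ 2 u x →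
        HasDerivAt (fun t : ℝ => ⟪gradient u (x + t • ξ), ξ⟫_ℝ)
          ⟪fderiv ℝ (gradient u) x ξ, ξ⟫_ℝ 0 := by
      intro u x ξ h
      have h1 : HasDerivAt (fun t : ℝ => x + t • ξ) ξ 0 := by
        simpa using ((hasDerivAt_id (0 : ℝ)).smul_const ξ).const_add x
      have h2 : HasFDerivAt (gradient u) (fderiv ℝ (gradient u) x) (x + (0 : ℝ) • ξ) := by
        simpa using (differentiableAt_gradient h).hasFDerivAt
      have h3 := (h2.comp_hasDerivAt (0 : ℝ) h1).inner ℝ (hasDerivAt_const (0 : ℝ) ξ)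
      simpa using h3
    have e₁ := hasDerivAt_line (hev ξ₁ h₁).self_of_nhds
    have e₂ := hasDerivAt_line (hev ξ₂ h₂).self_of_nhds
    have q₁ := hasDerivAt_quad_line (α := α) (ν := ν) (p := p) hH x₁ ξ₁ 0
    have q₂ := hasDerivAt_quad_line (α := α) (ν := ν) (p := p) hH x₂ ξ₂ 0
    have l : ∀ A B : ℝ, HasDerivAt (fun t : ℝ => A + t * B) B 0 := by
      intro A B
      simpa using ((hasDerivAt_id (0 : ℝ)).mul_const B).const_add A
    have hder := (((l ⟪x₂ - x₁, ξ₂ - ξ₁⟫_ℝ (‖ξ₂ - ξ₁‖ ^ 2)).const_mul 2).add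
      (((e₂.sub e₁).mul ((hgr ξ₂ h₂).sub (hgr ξ₁ h₁))).const_mul 2)).sub
      ((((l ⟪ν + H (x₁ - p), ξ₁⟫_ℝ ⟪H ξ₁, ξ₁⟫_ℝ).mul q₂).add
        (q₁.mul (l ⟪ν + H (x₂ - p), ξ₂⟫_ℝ ⟪H ξ₂, ξ₂⟫_ℝ))).const_mul c)
    have := deriv2_nonneg_of_isLocalMin (f' := f' ξ₁ ξ₂) (hlm ξ₁ ξ₂)
      (by filter_upwards [hev ξ₁ h₁, hev ξ₂ h₂] with t t₁ t₂ using hd ξ₁ ξ₂ t t₁ t₂) hder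
    simp only [zero_smul, add_zero, zero_mul] at this
    refine this.trans_eq ?_
    simp
    ring

theorem contact_height_pos {U : Set E2} (hU : IsOpen U) (hUc : Convex ℝ U) {u₁ u₂ : E2 → ℝ}
    {x₁ x₂ b : E2} {c s₁ s₂ : ℝ} (hu₂ : ContDiffOn ℝ 2 u₂ U) (hx₁ : x₁ ∈ U) (hx₂ : x₂ ∈ U)
    (hlt : u₁ x₁ < u₂ x₁) (hosc : ∀ x ∈ U, ‖gradient u₂ x - gradient u₂ x₂‖ ≤ 1 / 4)
    (hc : 0 < c) (hc' : c ≤ 1 / 32) (hs₁ : 0 < s₁) (hs₂ : 0 < s₂)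
    (hY : ‖x₂ - x₁‖ ^ 2 + (u₂ x₂ - u₁ x₁) ^ 2 = c * s₁ * s₂) (hb : ‖b‖ ≤ 2)
    (hs : |s₂ - s₁| ≤ 2 * ‖x₂ - x₁‖)
    (hG₂ : x₂ - x₁ + (u₂ x₂ - u₁ x₁) • gradient u₂ x₂ = (c / 2 * s₁) • b) :
    0 < u₂ x₂ - u₁ x₁ := by
  have hmv : |u₂ x₁ - u₂ x₂ - ⟪gradient u₂ x₂, x₁ - x₂⟫_ℝ| ≤ 1 / 4 * ‖x₁ - x₂‖ := by
    have hdiff : ∀ x ∈ U, DifferentiableAt ℝ u₂ x := fun x hx =>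
      (hu₂.contDiffAt (hU.mem_nhds hx)).differentiableAt (by norm_num)
    have := hUc.norm_image_sub_le_of_norm_hasFDerivWithin_le'
      (f := u₂) (f' := fun x => InnerProductSpace.toDual ℝ E2 (gradient u₂ x))
      (φ := InnerProductSpace.toDual ℝ E2 (gradient u₂ x₂)) (C := 1 / 4)
      (fun x hx => (hdiff x hx).hasGradientAt.hasFDerivAt.hasFDerivWithinAt)
      (fun x hx => by rw [← map_sub, LinearIsometryEquiv.norm_map]; exact hosc x hx) hx₂ hx₁
    simpa only [Real.norm_eq_abs, InnerProductSpace.toDual_apply_apply] using this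
  set y := x₂ - x₁ with hy
  set z := u₂ x₂ - u₁ x₁ with hz
  rw [← neg_sub x₂ x₁, ← hy, inner_neg_right, norm_neg] at hmv
  obtain ⟨d, hd, hd2⟩ : ∃ d : ℝ, 0 < d ∧ d ^ 2 = c * s₁ * s₂ :=
    ⟨√(c * s₁ * s₂), by positivity, Real.sq_sqrt (by positivity)⟩
  have hyd : ‖y‖ ≤ d := abs_le_of_sq_le_sq' (by nlinarith) hd.le |>.2
  have hcs : c * s₁ ≤ d / 4 := mul_le_quarter_of_sq_eq hc hc' hs₂ hs₁ hd.le (by rw [hd2]; ring)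
    (by rw [abs_sub_comm]; linarith)
  have hin : ‖y‖ ^ 2 + z * ⟪gradient u₂ x₂, y⟫_ℝ = c / 2 * s₁ * ⟪b, y⟫_ℝ := by
    rw [← real_inner_smul_left b y (c / 2 * s₁), ← hG₂, inner_add_left, real_inner_smul_left,
      real_inner_self_eq_norm_sq]
  have hby : c / 2 * s₁ * ⟪b, y⟫_ℝ ≤ d / 4 * d := by
    have h1 : ⟪b, y⟫_ℝ ≤ 2 * d := (real_inner_le_norm _ _).trans (by gcongr)
    have h2 : c / 2 * s₁ * ⟪b, y⟫_ℝ ≤ c / 2 * s₁ * (2 * d) := by gcongr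
    nlinarith
  have h3 : 3 / 4 * d ^ 2 ≤ z * (z - ⟪gradient u₂ x₂, y⟫_ℝ) := by nlinarith
  have h4 : -(1 / 4 * ‖y‖) ≤ z - ⟪gradient u₂ x₂, y⟫_ℝ := by
    have := (abs_le.1 hmv).2
    linarith
  by_contra! hneg
  have h5 : z * (z - ⟪gradient u₂ x₂, y⟫_ℝ) ≤ z * -(1 / 4 * ‖y‖) :=
    mul_le_mul_of_nonpos_left h4 hneg
  nlinarith [sq_nonneg (z + ‖y‖), sq_pos_of_pos hd]

theorem no_contact {U : Set E2} (hU : IsOpen U) (hUc : Convex ℝ U) {u₁ u₂ : E2 → ℝ}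
    {x₁ x₂ ν p : E2} {α c h κ lam₁ lam₂ : ℝ} {H : E2 →L[ℝ] E2} (hle : lam₂ ≤ lam₁)
    (h₁ : SatisfiesSolitonEq lam₁ U u₁) (h₂ : SatisfiesSolitonEq lam₂ U u₂)
    (hlt : ∀ x ∈ U, u₁ x < u₂ x)
    (hosc : ∀ x ∈ U, ∀ x' ∈ U, ‖gradient u₂ x - gradient u₂ x'‖ ≤ 1 / 4)
    (hHs : ∀ v w, ⟪H v, w⟫_ℝ = ⟪H w, v⟫_ℝ) (hh : 0 ≤ h) (hH : ∀ v, ‖H v‖ ≤ h * ‖v‖)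
    (hgrad : ∀ x ∈ U, ‖ν + H (x - p)‖ ≤ 2) (hquad : ∀ x ∈ U, quad α ν H p x * h ≤ 2)
    (hκ : 4 * |lam₁| + 2 ≤ κ)
    (hκ₁ : ∀ x ∈ U, κ ≤ ∑ i : Fin 2, H (EuclideanSpace.single i 1) i
      - ⟪H (gradient u₁ x), gradient u₁ x⟫_ℝ / W u₁ x ^ 2)
    (hκ₂ : ∀ x ∈ U, κ ≤ ∑ i : Fin 2, H (EuclideanSpace.single i 1) i
      - ⟪H (gradient u₂ x), gradient u₂ x⟫_ℝ / W u₂ x ^ 2)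
    (hc : 0 < c) (hc' : c ≤ 1 / 32) (hch : 64 * c * h ≤ 1) (hx₁ : x₁ ∈ U) (hx₂ : x₂ ∈ U)
    (hs₁ : 0 < quad α ν H p x₁) (hs₂ : 0 < quad α ν H p x₂)
    (hY : ‖x₂ - x₁‖ ^ 2 + (u₂ x₂ - u₁ x₁) ^ 2 = c * quad α ν H p x₁ * quad α ν H p x₂)
    (hmin : IsLocalMin (fun q : E2 × E2 => ‖q.2 - q.1‖ ^ 2 + (u₂ q.2 - u₁ q.1) ^ 2
      - c * (quad α ν H p q.1 * quad α ν H p q.2)) (x₁, x₂)) : False := by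
  obtain ⟨hG₁, hG₂, hsecond⟩ := contact_conditions hHs (h₁.1.contDiffAt (hU.mem_nhds hx₁))
    (h₂.1.contDiffAt (hU.mem_nhds hx₂)) hmin
  have hs := quad_sub_quad (α := α) (ν := ν) (p := p) hHs x₁ x₂
  have hs' : |quad α ν H p x₂ - quad α ν H p x₁| ≤ 2 * ‖x₂ - x₁‖ := by
    have h1 : |⟪(ν + H (x₁ - p)) + (ν + H (x₂ - p)), x₂ - x₁⟫_ℝ| ≤ 4 * ‖x₂ - x₁‖ := by
      refine (abs_real_inner_le_norm _ _).trans ?_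
      gcongr
      linarith [norm_add_le (ν + H (x₁ - p)) (ν + H (x₂ - p)), hgrad x₁ hx₁, hgrad x₂ hx₂]
    rw [hs, abs_div, abs_two]
    linarith
  have hz := contact_height_pos hU hUc h₂.1 hx₁ hx₂ (hlt x₁ hx₁) (fun x hx => hosc x hx x₂ hx₂)
    hc hc' hs₁ hs₂ hY (hgrad x₂ hx₂) hs' hG₂
  refine no_interior_contact (H := H) hz hc hc' hh hch hs₁ hs₂ (hquad x₂ hx₂) hY ?_ hs
    (hgrad x₁ hx₁) (hgrad x₂ hx₂) hH hG₁ hG₂ (W_pos u₁ x₁) (W_pos u₂ x₂) (W_sq u₁ x₁)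
    (W_sq u₂ x₂) (h₁.trace_eq hU hx₁) (h₂.trace_eq hU hx₂) (hκ₁ x₁ hx₁) (hκ₂ x₂ hx₂) hκ hle
    hsecond
  rw [add_sub_add_left_eq_sub, ← map_sub]
  congr 1
  abel

/-- The Hessian of `x ↦ K⟪x, ν⟫² - M‖x‖²`. -/
noncomputable def barrierHess (K M : ℝ) (ν : E2) : E2 →L[ℝ] E2 :=
  (2 * K) • (innerSL ℝ ν).smulRight ν - (2 * M) • ContinuousLinearMap.id ℝ E2

theorem barrierHess_apply (K M : ℝ) (ν v : E2) :
    barrierHess K M ν v = (2 * K * ⟪ν, v⟫_ℝ) • ν - (2 * M) • v := by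
  simp [barrierHess, smul_smul]

theorem inner_barrierHess (K M : ℝ) (ν v w : E2) :
    ⟪barrierHess K M ν v, w⟫_ℝ = 2 * K * (⟪ν, v⟫_ℝ * ⟪ν, w⟫_ℝ) - 2 * M * ⟪v, w⟫_ℝ := by
  rw [barrierHess_apply, inner_sub_left, real_inner_smul_left, real_inner_smul_left]
  ring

theorem norm_barrierHess_le {K M : ℝ} {ν : E2} (hK : 0 ≤ K) (hM : 0 ≤ M) (hν : ‖ν‖ = 1) (v : E2) :
    ‖barrierHess K M ν v‖ ≤ (2 * K + 2 * M) * ‖v‖ := by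
  rw [barrierHess_apply]
  refine (norm_sub_le _ _).trans ?_
  have h1 : |⟪ν, v⟫_ℝ| ≤ ‖v‖ := by simpa [hν] using abs_real_inner_le_norm ν v
  rw [norm_smul, norm_smul, hν, Real.norm_eq_abs, Real.norm_eq_abs, abs_mul,
    abs_of_nonneg (by positivity : 0 ≤ 2 * K), abs_of_nonneg (by positivity : 0 ≤ 2 * M)]
  have h2 : 2 * K * |⟪ν, v⟫_ℝ| ≤ 2 * K * ‖v‖ := by gcongr
  linarith

theorem le_trace_barrierHess {K M L w : ℝ} {ν G : E2} (hK : 0 ≤ K) (hM : 0 ≤ M) (hν : ‖ν‖ = 1)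
    (hG : ‖G‖ ≤ L) (hw : w ^ 2 = 1 + ‖G‖ ^ 2) :
    2 * K / (1 + L ^ 2) - 4 * M ≤ ∑ i : Fin 2, barrierHess K M ν (EuclideanSpace.single i 1) i
      - ⟪barrierHess K M ν G, G⟫_ℝ / w ^ 2 := by
  have htr : ∑ i : Fin 2, barrierHess K M ν (EuclideanSpace.single i 1) i = 2 * K - 4 * M := by
    have hν2 : ν 0 ^ 2 + ν 1 ^ 2 = 1 := by
      have := EuclideanSpace.real_norm_sq_eq ν
      rw [hν, Fin.sum_univ_two] at this
      linarith
    simp only [barrierHess_apply, Fin.sum_univ_two, EuclideanSpace.inner_single_right]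
    simp
    linear_combination 2 * K * hν2
  have hw0 : 0 < w ^ 2 := by rw [hw]; positivity
  rw [htr, inner_barrierHess, real_inner_self_eq_norm_sq]
  have h1 : ⟪ν, G⟫_ℝ * ⟪ν, G⟫_ℝ ≤ ‖G‖ ^ 2 := by
    have := abs_real_inner_le_norm ν G
    rw [hν, one_mul] at this
    rw [← pow_two, ← sq_abs]
    gcongr
  have h2 : 2 * K / (1 + L ^ 2) ≤ 2 * K / w ^ 2 := by
    rw [hw]
    gcongr
  have h3 : (2 * K * (⟪ν, G⟫_ℝ * ⟪ν, G⟫_ℝ) - 2 * M * ‖G‖ ^ 2) / w ^ 2 ≤ 2 * K - 2 * K / w ^ 2 := by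
    have : 2 * K - 2 * K / w ^ 2 = 2 * K * ‖G‖ ^ 2 / w ^ 2 := by
      rw [eq_div_iff hw0.ne', sub_mul, div_mul_cancel₀ _ hw0.ne', hw]; ring
    rw [this]
    gcongr
    have h4 : 0 ≤ 2 * M * ‖G‖ ^ 2 := by positivity
    have h5 : 2 * K * (⟪ν, G⟫_ℝ * ⟪ν, G⟫_ℝ) ≤ 2 * K * ‖G‖ ^ 2 := by gcongr
    linarith
  linarith

/-- Near `p` the superlevel set of the barrier touches the complement of the ball only at `p`. -/
theorem mem_ball_of_barrier_nonneg {K M r ρ : ℝ} {ν p x : E2} (hr : 0 < r) (hK : 0 ≤ K)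
    (hM : M = 2 / r) (hν : ‖ν‖ = 1) (hKρ : K * ρ ≤ 1) (hx : x ∈ Metric.closedBall p ρ)
    (hxp : x ≠ p) (hq : 0 ≤ quad 0 ν (barrierHess K M ν) p x) :
    x ∈ Metric.ball (p + r • ν) r := by
  rw [mem_closedBall_iff_norm] at hx
  rw [mem_ball_iff_norm]
  have hv : x - (p + r • ν) = (x - p) - r • ν := by abel
  rw [quad, inner_barrierHess, real_inner_self_eq_norm_sq] at hq
  have hpos : 0 < ‖x - p‖ := norm_pos_iff.2 (sub_ne_zero.2 hxp)
  have hy : |⟪ν, x - p⟫_ℝ| ≤ ‖x - p‖ := by simpa [hν] using abs_real_inner_le_norm ν (x - p)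
  rw [hv]
  set v := x - p
  set y := ⟪ν, v⟫_ℝ with hy'
  have h1 : K * |y| ≤ 1 := (mul_le_mul_of_nonneg_left (hy.trans hx) hK).trans hKρ
  have hM' : M * r = 2 := by rw [hM]; field_simp
  have hM0 : 0 < M := by rw [hM]; positivity
  have h2 : M * ‖v‖ ^ 2 ≤ y * (1 + K * y) := by linarith
  have h3 : 0 < M * ‖v‖ ^ 2 := by positivity
  have h4 : |K * y| ≤ 1 := by rwa [abs_mul, abs_of_nonneg hK]
  have h5 := abs_le.1 h4
  have h6 : 0 < y := by
    by_contra! h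
    nlinarith
  have h7 : M * ‖v‖ ^ 2 ≤ y * 2 := h2.trans (by gcongr; linarith)
  have h8 : ‖v‖ ^ 2 ≤ r * y := by nlinarith
  have h9 : ‖v - r • ν‖ ^ 2 < r ^ 2 := by
    rw [norm_sub_sq_real, norm_smul, hν, Real.norm_of_nonneg hr.le, real_inner_smul_right,
      real_inner_comm, ← hy']
    nlinarith [mul_pos hr h6]
  exact lt_of_pow_lt_pow_left₀ 2 hr.le h9

theorem quad_neg (η : ℝ) (ν : E2) (H : E2 →L[ℝ] E2) (p x : E2) :
    quad (-η) ν H p x = quad 0 ν H p x - η := by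
  unfold quad; ring

theorem continuous_quad (α : ℝ) (ν : E2) (H : E2 →L[ℝ] E2) (p : E2) :
    Continuous (quad α ν H p) := by
  unfold quad; fun_prop

theorem exists_separation {R : Set E2} {u₁ u₂ : E2 → ℝ} {p : E2} {ρ : ℝ} {q : E2 → ℝ}
    (hq : Continuous q) (hρ : 0 < ρ) (hc₁ : ContinuousOn u₁ (insert p R))
    (hc₂ : ContinuousOn u₂ (insert p R)) (hlt : ∀ x ∈ R, u₁ x < u₂ x)
    (hK : ∀ x ∈ Metric.closedBall p ρ, x ≠ p → 0 ≤ q x → x ∈ R) :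
    ∃ m > 0, ∀ x₁ ∈ Metric.closedBall p ρ, ∀ x₂ ∈ Metric.closedBall p ρ, 0 ≤ q x₁ → 0 ≤ q x₂ →
      dist x₁ p = ρ ∨ dist x₂ p = ρ → m ≤ ‖x₂ - x₁‖ ^ 2 + (u₂ x₂ - u₁ x₁) ^ 2 := by
  let K : Set E2 := Metric.closedBall p ρ ∩ {x | 0 ≤ q x}
  have hKc : IsCompact K :=
    (isCompact_closedBall p ρ).inter_right (isClosed_le continuous_const hq)
  have hKR : K ⊆ insert p R := fun x hx => by
    by_cases h : x = p
    · exact Or.inl h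
    · exact Or.inr (hK x hx.1 h hx.2)
  let S : Set (E2 × E2) := (K ×ˢ K) ∩ {z | dist z.1 p = ρ ∨ dist z.2 p = ρ}
  have hSc : IsCompact S := (hKc.prod hKc).inter_right
    ((isClosed_eq (by fun_prop) continuous_const).union
      (isClosed_eq (by fun_prop) continuous_const))
  have hcont : ContinuousOn (fun z : E2 × E2 => ‖z.2 - z.1‖ ^ 2 + (u₂ z.2 - u₁ z.1) ^ 2) S := by
    have h1 : ContinuousOn (fun z : E2 × E2 => u₁ z.1) S :=
      hc₁.comp continuous_fst.continuousOn fun z hz => hKR hz.1.1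
    have h2 : ContinuousOn (fun z : E2 × E2 => u₂ z.2) S :=
      hc₂.comp continuous_snd.continuousOn fun z hz => hKR hz.1.2
    have h3 : ContinuousOn (fun z : E2 × E2 => ‖z.2 - z.1‖ ^ 2) S := by fun_prop
    exact h3.add ((h2.sub h1).pow 2)
  obtain ⟨m, hm, hm'⟩ := hSc.exists_forall_le' hcont (a := 0) (by
    rintro ⟨x₁, x₂⟩ ⟨⟨h1, h2⟩, h3⟩
    by_contra! hle
    simp only at hle h1 h2
    have hx : x₂ = x₁ := by
      have : ‖x₂ - x₁‖ = 0 := by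
        by_contra hne
        have : 0 < ‖x₂ - x₁‖ := lt_of_le_of_ne (norm_nonneg _) (Ne.symm hne)
        nlinarith [sq_nonneg (u₂ x₂ - u₁ x₁)]
      exact sub_eq_zero.1 (norm_eq_zero.1 this)
    subst hx
    have hne : x₂ ≠ p := by
      rintro rfl
      simp at h3
      linarith
    have := hlt x₂ (hK x₂ h1.1 hne h1.2)
    nlinarith [sq_nonneg ‖x₂ - x₂‖, sub_pos.2 this])
  exact ⟨m, hm, fun x₁ h1 x₂ h2 q1 q2 h => hm' (x₁, x₂) ⟨⟨⟨h1, q1⟩, ⟨h2, q2⟩⟩, h⟩⟩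

set_option maxHeartbeats 800000 in
theorem two_point_barrier {R : Set E2} (hR : IsOpen R) (hRc : Convex ℝ R) {u₁ u₂ : E2 → ℝ}
    {ν p : E2} {h κ lam₁ lam₂ ρ Q : ℝ} {H : E2 →L[ℝ] E2} (hle : lam₂ ≤ lam₁)
    (h₁ : SatisfiesSolitonEq lam₁ R u₁) (h₂ : SatisfiesSolitonEq lam₂ R u₂)
    (hc₁ : ContinuousOn u₁ (insert p R)) (hc₂ : ContinuousOn u₂ (insert p R))
    (hlt : ∀ x ∈ R, u₁ x < u₂ x) (hρ : 0 < ρ)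
    (hK : ∀ x ∈ Metric.closedBall p ρ, x ≠ p → 0 ≤ quad 0 ν H p x → x ∈ R)
    (hosc : ∀ x ∈ R ∩ Metric.ball p ρ, ∀ x' ∈ R ∩ Metric.ball p ρ,
      ‖gradient u₂ x - gradient u₂ x'‖ ≤ 1 / 4)
    (hHs : ∀ v w, ⟪H v, w⟫_ℝ = ⟪H w, v⟫_ℝ) (hh : 0 ≤ h) (hH : ∀ v, ‖H v‖ ≤ h * ‖v‖)
    (hgrad : ∀ x ∈ Metric.closedBall p ρ, ‖ν + H (x - p)‖ ≤ 2)
    (hquad : ∀ x ∈ Metric.closedBall p ρ, quad 0 ν H p x ≤ Q) (hQ : 0 < Q) (hQh : Q * h ≤ 2)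
    (hκ : 4 * |lam₁| + 2 ≤ κ)
    (hκ₁ : ∀ x ∈ R ∩ Metric.ball p ρ, κ ≤ ∑ i : Fin 2, H (EuclideanSpace.single i 1) i
      - ⟪H (gradient u₁ x), gradient u₁ x⟫_ℝ / W u₁ x ^ 2)
    (hκ₂ : ∀ x ∈ R ∩ Metric.ball p ρ, κ ≤ ∑ i : Fin 2, H (EuclideanSpace.single i 1) i
      - ⟪H (gradient u₂ x), gradient u₂ x⟫_ℝ / W u₂ x ^ 2) :
    ∃ c > 0, ∀ x ∈ Metric.closedBall p ρ, 0 < quad 0 ν H p x →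
      c * quad 0 ν H p x ^ 2 ≤ (u₂ x - u₁ x) ^ 2 := by
  obtain ⟨m, hm, hsep⟩ :=
    exists_separation (continuous_quad 0 ν H p) hρ hc₁ hc₂ hlt hK
  obtain ⟨c₀, hc₀, hc32, hch, hcm⟩ : ∃ c₀ : ℝ, 0 < c₀ ∧ c₀ ≤ 1 / 32 ∧ 64 * c₀ * h ≤ 1 ∧
      c₀ * Q ^ 2 ≤ m := by
    refine ⟨min (1 / 32) (min (1 / (64 * (h + 1))) (m / Q ^ 2)), by positivity, min_le_left _ _,
      ?_, ?_⟩
    · have h1 : min (1 / 32) (min (1 / (64 * (h + 1))) (m / Q ^ 2)) ≤ 1 / (64 * (h + 1)) :=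
        (min_le_right _ _).trans (min_le_left _ _)
      rw [le_div_iff₀ (by positivity)] at h1
      have h2 : 0 < min (1 / 32) (min (1 / (64 * (h + 1))) (m / Q ^ 2)) := by positivity
      linarith
    · have h1 : min (1 / 32) (min (1 / (64 * (h + 1))) (m / Q ^ 2)) ≤ m / Q ^ 2 :=
        (min_le_right _ _).trans (min_le_right _ _)
      rwa [le_div_iff₀ (by positivity)] at h1
  refine ⟨c₀, hc₀, fun x hx hqx => ?_⟩
  have hη : ∀ η, 0 < η → η < quad 0 ν H p x →
      c₀ * (quad 0 ν H p x - η) ^ 2 ≤ (u₂ x - u₁ x) ^ 2 := by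
    intro η hη hηx
    by_contra! hcon
    let K : Set E2 := Metric.closedBall p ρ ∩ {x | η ≤ quad 0 ν H p x}
    have hKc : IsCompact K :=
      (isCompact_closedBall p ρ).inter_right (isClosed_le continuous_const (continuous_quad _ _ _ _))
    have hqp : quad 0 ν H p p = 0 := by simp [quad]
    have hKR : K ⊆ R := fun x hx => hK x hx.1
      (by rintro rfl; have := hx.2; simp only [Set.mem_ofPred_eq, hqp] at this; linarith)
      (hη.le.trans hx.2)
    have hxK : x ∈ K := ⟨hx, hηx.le⟩
    let Y : E2 × E2 → ℝ := fun z => ‖z.2 - z.1‖ ^ 2 + (u₂ z.2 - u₁ z.1) ^ 2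
    let P : E2 × E2 → ℝ := fun z => quad (-η) ν H p z.1 * quad (-η) ν H p z.2
    have hYpos : ∀ z ∈ K ×ˢ K, 0 < Y z := by
      rintro ⟨x₁, x₂⟩ ⟨h1, h2⟩
      by_contra! hle
      simp only [Y] at hle h1 h2
      have hx : x₂ = x₁ := by
        have : ‖x₂ - x₁‖ = 0 := by
          by_contra hne
          have : 0 < ‖x₂ - x₁‖ := lt_of_le_of_ne (norm_nonneg _) (Ne.symm hne)
          nlinarith [sq_nonneg (u₂ x₂ - u₁ x₁)]
        exact sub_eq_zero.1 (norm_eq_zero.1 this)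
      subst hx
      have := hlt x₂ (hKR h1)
      nlinarith [sq_nonneg ‖x₂ - x₂‖, sub_pos.2 this]
    have hYc : ContinuousOn Y (K ×ˢ K) := by
      have h1 : ContinuousOn (fun z : E2 × E2 => u₁ z.1) (K ×ˢ K) :=
        hc₁.comp continuous_fst.continuousOn fun z hz => Or.inr (hKR hz.1)
      have h2 : ContinuousOn (fun z : E2 × E2 => u₂ z.2) (K ×ˢ K) :=
        hc₂.comp continuous_snd.continuousOn fun z hz => Or.inr (hKR hz.2)
      have h3 : ContinuousOn (fun z : E2 × E2 => ‖z.2 - z.1‖ ^ 2) (K ×ˢ K) := by fun_prop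
      exact h3.add ((h2.sub h1).pow 2)
    have hPc : Continuous P := by
      have := continuous_quad (-η) ν H p
      fun_prop
    obtain ⟨⟨a₁, a₂⟩, haK, hmax⟩ := (hKc.prod hKc).exists_isMaxOn ⟨(x, x), hxK, hxK⟩
      (hPc.continuousOn.div hYc fun z hz => (hYpos z hz).ne')
    have hmax' : ∀ z ∈ K ×ˢ K, P z / Y z ≤ P (a₁, a₂) / Y (a₁, a₂) := fun z hz => hmax hz
    have hYa := hYpos _ haK
    have hxx : (x, x) ∈ K ×ˢ K := ⟨hxK, hxK⟩
    have hbig : 1 / c₀ < P (a₁, a₂) / Y (a₁, a₂) := by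
      refine lt_of_lt_of_le ?_ (hmax' (x, x) hxx)
      rw [div_lt_div_iff₀ hc₀ (hYpos (x, x) hxx)]
      simp only [P, Y, quad_neg, sub_self, norm_zero]
      linarith
    set F := P (a₁, a₂) / Y (a₁, a₂) with hF
    have hFpos : 0 < F := lt_trans (by positivity) hbig
    have hcc : 1 / F < c₀ := by
      rw [div_lt_comm₀ hFpos hc₀]; exact hbig
    have hYF : Y (a₁, a₂) = 1 / F * P (a₁, a₂) := by
      have : P (a₁, a₂) ≠ 0 := fun h0 => by simp [hF, h0] at hFpos
      rw [hF]; field_simp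
    have hPpos : 0 < P (a₁, a₂) := by
      by_contra! h0
      have : 1 / F * P (a₁, a₂) ≤ 0 := mul_nonpos_of_nonneg_of_nonpos (by positivity) h0
      linarith
    have hn₁ : 0 ≤ quad (-η) ν H p a₁ := by rw [quad_neg]; exact sub_nonneg.2 haK.1.2
    have hn₂ : 0 ≤ quad (-η) ν H p a₂ := by rw [quad_neg]; exact sub_nonneg.2 haK.2.2
    have hs₁ : 0 < quad (-η) ν H p a₁ :=
      lt_of_le_of_ne hn₁ fun h0 => by simp [P, ← h0] at hPpos
    have hs₂ : 0 < quad (-η) ν H p a₂ :=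
      lt_of_le_of_ne hn₂ fun h0 => by simp [P, ← h0] at hPpos
    have hPQ : P (a₁, a₂) ≤ Q ^ 2 := by
      rw [pow_two]
      have l₁ := hquad a₁ haK.1.1
      have l₂ := hquad a₂ haK.2.1
      exact mul_le_mul (by rw [quad_neg]; linarith) (by rw [quad_neg]; linarith) hn₂ hQ.le
    have hYm : Y (a₁, a₂) < m := by
      rw [hYF]
      calc 1 / F * P (a₁, a₂) < c₀ * P (a₁, a₂) := by gcongr
        _ ≤ c₀ * Q ^ 2 := by gcongr
        _ ≤ m := hcm
    have hball : a₁ ∈ Metric.ball p ρ ∧ a₂ ∈ Metric.ball p ρ := by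
      have hno : ¬ (dist a₁ p = ρ ∨ dist a₂ p = ρ) := fun hor =>
        (hsep a₁ haK.1.1 a₂ haK.2.1 (hη.le.trans haK.1.2) (hη.le.trans haK.2.2) hor).not_gt hYm
      push Not at hno
      exact ⟨lt_of_le_of_ne haK.1.1 hno.1, lt_of_le_of_ne haK.2.1 hno.2⟩
    have hKn : ∀ {a : E2}, a ∈ Metric.ball p ρ → 0 < quad (-η) ν H p a → K ∈ nhds a := by
      intro a ha hqa
      have : Metric.ball p ρ ∩ {x | 0 < quad (-η) ν H p x} ∈ nhds a :=
        (Metric.isOpen_ball.inter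
          (isOpen_lt continuous_const (continuous_quad _ _ _ _))).mem_nhds ⟨ha, hqa⟩
      refine Filter.mem_of_superset this fun y hy => ⟨Metric.ball_subset_closedBall hy.1, ?_⟩
      have := hy.2
      rw [Set.mem_ofPred_eq, quad_neg] at this
      exact (sub_pos.1 this).le
    refine no_contact (U := R ∩ Metric.ball p ρ) (hR.inter Metric.isOpen_ball)
      (hRc.inter (convex_ball p ρ)) hle ⟨h₁.1.mono Set.inter_subset_left, fun x hx => h₁.2 x hx.1⟩
      ⟨h₂.1.mono Set.inter_subset_left, fun x hx => h₂.2 x hx.1⟩ (fun x hx => hlt x hx.1) hosc hHs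
      hh hH (fun x hx => hgrad x (Metric.ball_subset_closedBall hx.2)) (α := -η) (c := 1 / F) ?_ hκ
      hκ₁ hκ₂ (by positivity) (hcc.le.trans hc32) ?_ ⟨hKR haK.1, hball.1⟩ ⟨hKR haK.2, hball.2⟩
      hs₁ hs₂ ?_ ?_
    · intro y hy
      rw [quad_neg]
      have := hquad y (Metric.ball_subset_closedBall hy.2)
      exact le_trans (by gcongr; linarith) hQh
    · exact le_trans (by gcongr) hch
    · rw [mul_assoc]; exact hYF
    · have hnh : K ×ˢ K ∈ nhds (a₁, a₂) := prod_mem_nhds (hKn hball.1 hs₁) (hKn hball.2 hs₂)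
      filter_upwards [hnh] with z hz
      have e₁ := hmax' z hz
      rw [div_le_iff₀ (hYpos z hz)] at e₁
      have e₂ : 1 / F * P z ≤ Y z := by
        rw [one_div, inv_mul_le_iff₀ hFpos]; exact e₁
      have e₃ : Y (a₁, a₂) - 1 / F * P (a₁, a₂) ≤ Y z - 1 / F * P z := by linarith
      exact e₃
  have hlim : Filter.Tendsto (fun η : ℝ => c₀ * (quad 0 ν H p x - η) ^ 2) (nhdsWithin 0 (Set.Ioi 0))
      (nhds (c₀ * quad 0 ν H p x ^ 2)) := by
    have : Continuous fun η : ℝ => c₀ * (quad 0 ν H p x - η) ^ 2 := by fun_prop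
    simpa using (this.tendsto 0).mono_left nhdsWithin_le_nhds
  refine le_of_tendsto hlim ?_
  filter_upwards [Ioo_mem_nhdsGT hqx] with η hη' using hη η hη'.1 hη'.2

/-- A boundary point lemma for ordered soliton graphs over a disc whose gradients extend
continuously to a boundary point. -/
theorem SatisfiesSolitonEq.boundary_point {p ν : E2} {r lam₁ lam₂ : ℝ} (hr : 0 < r) (hν : ‖ν‖ = 1)
    {u₁ u₂ : E2 → ℝ} (hle : lam₂ ≤ lam₁)
    (h₁ : SatisfiesSolitonEq lam₁ (Metric.ball (p + r • ν) r) u₁)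
    (h₂ : SatisfiesSolitonEq lam₂ (Metric.ball (p + r • ν) r) u₂)
    (hlt : ∀ x ∈ Metric.ball (p + r • ν) r, u₁ x < u₂ x) {P₁ P₂ : E2}
    (hP₁ : Filter.Tendsto (gradient u₁) (nhdsWithin p (Metric.ball (p + r • ν) r)) (nhds P₁))
    (hP₂ : Filter.Tendsto (gradient u₂) (nhdsWithin p (Metric.ball (p + r • ν) r)) (nhds P₂))
    {f' : E2 →L[ℝ] ℝ} (hd₁ : HasFDerivWithinAt u₁ f' (insert p (Metric.ball (p + r • ν) r)) p)
    (hd₂ : HasFDerivWithinAt u₂ f' (insert p (Metric.ball (p + r • ν) r)) p)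
    (htouch : u₁ p = u₂ p) : False := by
  set R := Metric.ball (p + r • ν) r with hRdef
  have hR : IsOpen R := Metric.isOpen_ball
  have hcont : ∀ {u : E2 → ℝ}, ContDiffOn ℝ 2 u R → HasFDerivWithinAt u f' (insert p R) p →
      ContinuousOn u (insert p R) := by
    intro u hu hd x hx
    rcases hx with rfl | hx
    · exact hd.continuousWithinAt
    · exact (hu.contDiffAt (hR.mem_nhds hx)).continuousAt.continuousWithinAt
  obtain ⟨L, hL⟩ : ∃ L, L = ‖P₁‖ + ‖P₂‖ + 1 := ⟨_, rfl⟩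
  obtain ⟨M, hM⟩ : ∃ M, M = 2 / r := ⟨_, rfl⟩
  have hM0 : 0 < M := by rw [hM]; positivity
  obtain ⟨K, hK⟩ : ∃ K, K = (1 + L ^ 2) * ((4 * M + (4 * |lam₁| + 2)) / 2) := ⟨_, rfl⟩
  have hK' : 2 * K / (1 + L ^ 2) - 4 * M = 4 * |lam₁| + 2 := by
    have : 1 + L ^ 2 ≠ 0 := by positivity
    rw [hK]; field_simp; ring
  have hMK : 2 * M ≤ K := by
    have h1 : 2 * M ≤ (4 * M + (4 * |lam₁| + 2)) / 2 := by linarith [abs_nonneg lam₁]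
    rw [hK]
    nlinarith [sq_nonneg L]
  have hK0 : 0 < K := by linarith
  obtain ⟨ε, hε, hεR⟩ : ∃ ε > 0, ∀ x ∈ R ∩ Metric.ball p ε,
      ‖gradient u₁ x - P₁‖ < 1 ∧ ‖gradient u₂ x - P₂‖ < 1 / 8 := by
    have e₁ := (Metric.tendsto_nhds.1 hP₁) 1 one_pos
    have e₂ := (Metric.tendsto_nhds.1 hP₂) (1 / 8) (by norm_num)
    obtain ⟨ε, hε, hsub⟩ := Metric.mem_nhdsWithin_iff.1 (e₁.and e₂)
    refine ⟨ε, hε, fun x hx => ?_⟩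
    have := hsub ⟨hx.2, hx.1⟩
    simpa [dist_eq_norm] using this
  obtain ⟨ρ, hρ, hρε, hρh⟩ : ∃ ρ : ℝ, 0 < ρ ∧ ρ ≤ ε ∧ (2 * K + 2 * M) * ρ ≤ 1 := by
    refine ⟨min ε (1 / (2 * K + 2 * M)), by positivity, min_le_left _ _, ?_⟩
    have := min_le_right ε (1 / (2 * K + 2 * M))
    rwa [le_div_iff₀ (by positivity), mul_comm] at this
  have hεR' : ∀ x ∈ R ∩ Metric.ball p ρ,
      ‖gradient u₁ x - P₁‖ < 1 ∧ ‖gradient u₂ x - P₂‖ < 1 / 8 := fun x hx =>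
    hεR x ⟨hx.1, Metric.ball_subset_ball hρε hx.2⟩
  have hHn : ∀ x ∈ Metric.closedBall p ρ, ‖barrierHess K M ν (x - p)‖ ≤ 1 := by
    intro x hx
    refine (norm_barrierHess_le hK0.le hM0.le hν _).trans (le_trans ?_ hρh)
    rw [mem_closedBall_iff_norm] at hx
    gcongr
  obtain ⟨c, hc, hbar⟩ := two_point_barrier (R := R) (ν := ν) (p := p)
    (H := barrierHess K M ν) (h := 2 * K + 2 * M) (κ := 4 * |lam₁| + 2) (ρ := ρ) (Q := 2 * ρ)
    hR (convex_ball _ _) hle h₁ h₂ (hcont h₁.1 hd₁) (hcont h₂.1 hd₂) hlt hρ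
    (fun x hx hxp hq => mem_ball_of_barrier_nonneg hr hK0.le hM hν (by nlinarith) hx hxp hq)
    (fun x hx x' hx' => by
      have e₁ := (hεR' x hx).2
      have e₂ := (hεR' x' hx').2
      have := norm_sub_le (gradient u₂ x - P₂) (gradient u₂ x' - P₂)
      rw [sub_sub_sub_cancel_right] at this
      linarith)
    (fun v w => by
      rw [inner_barrierHess, inner_barrierHess, real_inner_comm w v]; ring)
    (by positivity) (norm_barrierHess_le hK0.le hM0.le hν)
    (fun x hx => by
      have := norm_add_le ν (barrierHess K M ν (x - p))
      linarith [hHn x hx])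
    (fun x hx => by
      have e₁ := hHn x hx
      rw [mem_closedBall_iff_norm] at hx
      have e₂ : ⟪ν, x - p⟫_ℝ ≤ ρ := (real_inner_le_norm _ _).trans (by rwa [hν, one_mul])
      have e₃ : ⟪barrierHess K M ν (x - p), x - p⟫_ℝ ≤ 1 * ρ :=
        (real_inner_le_norm _ _).trans (by gcongr)
      unfold quad
      linarith)
    (by positivity) (by linarith) le_rfl
    (fun x hx => by
      rw [← hK']
      refine le_trace_barrierHess hK0.le hM0.le hν ?_ (W_sq u₁ x)
      have e₁ := (hεR' x hx).1
      have e₂ := norm_sub_norm_le (gradient u₁ x) P₁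
      rw [hL]
      linarith [norm_nonneg P₂])
    (fun x hx => by
      rw [← hK']
      refine le_trace_barrierHess hK0.le hM0.le hν ?_ (W_sq u₂ x)
      have e₁ := (hεR' x hx).2
      have e₂ := norm_sub_norm_le (gradient u₂ x) P₂
      rw [hL]
      linarith [norm_nonneg P₁])
  have hlin : ∀ t : ℝ, 0 < t → t ≤ ρ → c * t ^ 2 ≤ (u₂ (p + t • ν) - u₁ (p + t • ν)) ^ 2 := by
    intro t ht htρ
    have hq : t ≤ quad 0 ν (barrierHess K M ν) p (p + t • ν) := by
      rw [quad, add_sub_cancel_left, inner_barrierHess, real_inner_self_eq_norm_sq, norm_smul,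
        real_inner_smul_right, real_inner_self_eq_norm_sq, hν, Real.norm_of_nonneg ht.le]
      nlinarith [mul_nonneg (by linarith : 0 ≤ K - M) (sq_nonneg t)]
    refine le_trans ?_ (hbar (p + t • ν) ?_ (ht.trans_le hq))
    · gcongr
    · rw [mem_closedBall_iff_norm, add_sub_cancel_left, norm_smul, hν, Real.norm_of_nonneg ht.le,
        mul_one]
      exact htρ
  have hdw : HasFDerivWithinAt (fun x => u₂ x - u₁ x) (f' - f') (insert p R) p := hd₂.sub hd₁
  have hpath : Filter.Tendsto (fun t : ℝ => p + t • ν) (nhdsWithin 0 (Set.Ioi 0))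
      (nhdsWithin p (insert p R)) := by
    refine tendsto_nhdsWithin_iff.2 ⟨?_, ?_⟩
    · have : Continuous fun t : ℝ => p + t • ν := by fun_prop
      simpa using (this.tendsto 0).mono_left nhdsWithin_le_nhds
    · filter_upwards [Ioo_mem_nhdsGT hr] with t ht
      refine Or.inr ?_
      rw [hRdef, mem_ball_iff_norm, add_sub_add_left_eq_sub, ← sub_smul, norm_smul, hν, mul_one,
        Real.norm_eq_abs, abs_lt]
      constructor <;> linarith [ht.1, ht.2]
  have hlo := (hdw.isLittleO.bound (by positivity : 0 < √c / 2))
  have hfin := (hpath.eventually hlo).and (Ioc_mem_nhdsGT hρ)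
  obtain ⟨t, ht, ht0, htρ⟩ := hfin.exists
  have h3 := hlin t ht0 htρ
  rw [sub_self, htouch] at ht
  simp only [sub_self, sub_zero, zero_apply, add_sub_cancel_left, norm_smul, hν,
    Real.norm_of_nonneg ht0.le, mul_one] at ht
  have h4 : (u₂ (p + t • ν) - u₁ (p + t • ν)) ^ 2 ≤ (√c / 2 * t) ^ 2 := by
    rw [← sq_abs]
    exact pow_le_pow_left₀ (abs_nonneg _) ht 2
  rw [mul_pow, div_pow, Real.sq_sqrt hc.le] at h4
  nlinarith [mul_pos hc (pow_pos ht0 2)]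

theorem tendsto_gradient_of_contDiffOn_insert {D : Set E2} (hD : IsOpen D) {p : E2} {u : E2 → ℝ}
    (hu : ContDiffOn ℝ 1 u (insert p D)) (hp : UniqueDiffWithinAt ℝ (insert p D) p) :
    Filter.Tendsto (gradient u) (nhdsWithin p D)
      (nhds ((InnerProductSpace.toDual ℝ E2).symm (fderivWithin ℝ u (insert p D) p))) := by
  have hnhds : ∀ x ∈ D, insert p D ∈ nhds x := fun x hx =>
    Filter.mem_of_superset (hD.mem_nhds hx) (Set.subset_insert p D)
  have huniq : UniqueDiffOn ℝ (insert p D) := by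
    rintro x (rfl | hx)
    · exact hp
    · exact uniqueDiffWithinAt_of_mem_nhds (hnhds x hx)
  have hcont := (hu.continuousOn_fderivWithin huniq le_rfl) p (Set.mem_insert p D)
  have hlim : Filter.Tendsto (fderivWithin ℝ u (insert p D)) (nhdsWithin p D)
      (nhds (fderivWithin ℝ u (insert p D) p)) :=
    hcont.mono_left (nhdsWithin_mono p (Set.subset_insert p D))
  refine (((InnerProductSpace.toDual ℝ E2).symm.continuous.tendsto _).comp hlim).congr' ?_
  filter_upwards [self_mem_nhdsWithin] with x hx
  simp [gradient, fderivWithin_of_mem_nhds (hnhds x hx)]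

/-- A boundary point lemma for ordered soliton graphs that are continuously differentiable up to
a point satisfying an interior ball condition. -/
theorem SatisfiesSolitonEq.boundary_point_of_contDiffOn_insert {D : Set E2} (hD : IsOpen D)
    {p y : E2} {r lam₁ lam₂ : ℝ} (hr : 0 < r) (hpy : dist y p = r) (hsub : Metric.ball y r ⊆ D)
    {u₁ u₂ : E2 → ℝ} (hle : lam₂ ≤ lam₁)
    (h₁ : SatisfiesSolitonEq lam₁ D u₁) (h₂ : SatisfiesSolitonEq lam₂ D u₂)
    (hext₁ : ContDiffOn ℝ 1 u₁ (insert p D)) (hext₂ : ContDiffOn ℝ 1 u₂ (insert p D))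
    (hlt : ∀ x ∈ Metric.ball y r, u₁ x < u₂ x) (htouch : u₁ p = u₂ p)
    (hgrad : fderivWithin ℝ u₁ (insert p D) p = fderivWithin ℝ u₂ (insert p D) p) : False := by
  obtain ⟨ν, hν, rfl⟩ : ∃ ν : E2, ‖ν‖ = 1 ∧ y = p + r • ν := by
    refine ⟨r⁻¹ • (y - p), ?_, ?_⟩
    · rw [norm_smul, ← dist_eq_norm, hpy, Real.norm_of_nonneg (by positivity),
        inv_mul_cancel₀ hr.ne']
    · rw [smul_smul, mul_inv_cancel₀ hr.ne', one_smul, add_sub_cancel]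
  have hsub' : insert p (Metric.ball (p + r • ν) r) ⊆ insert p D := Set.insert_subset_insert hsub
  have huniq : UniqueDiffWithinAt ℝ (insert p D) p := by
    refine (uniqueDiffWithinAt_convex (convex_ball (p + r • ν) r) ?_ ?_).mono
      (hsub.trans (Set.subset_insert p D))
    · rw [Metric.isOpen_ball.interior_eq]
      exact Metric.nonempty_ball.2 hr
    · rw [closure_ball _ hr.ne', Metric.mem_closedBall, dist_comm, hpy]
  have hlim : ∀ {u : E2 → ℝ}, ContDiffOn ℝ 1 u (insert p D) → Filter.Tendsto (gradient u)
      (nhdsWithin p (Metric.ball (p + r • ν) r))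
      (nhds ((InnerProductSpace.toDual ℝ E2).symm (fderivWithin ℝ u (insert p D) p))) :=
    fun hu => (tendsto_gradient_of_contDiffOn_insert hD hu huniq).mono_left
      (nhdsWithin_mono p hsub)
  have hder : ∀ {u : E2 → ℝ}, ContDiffOn ℝ 1 u (insert p D) → HasFDerivWithinAt u
      (fderivWithin ℝ u (insert p D) p) (insert p (Metric.ball (p + r • ν) r)) p :=
    fun hu => ((hu.differentiableOn one_ne_zero p
      (Set.mem_insert p D)).hasFDerivWithinAt).mono hsub'
  exact boundary_point hr hν hle ⟨h₁.1.mono hsub, fun x hx => h₁.2 x (hsub hx)⟩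
    ⟨h₂.1.mono hsub, fun x hx => h₂.2 x (hsub hx)⟩ hlt (hlim hext₁) (hlim hext₂)
    (hder hext₁) (hgrad ▸ hder hext₂) htouch

/-- The interior tangency principle: the contact set of two ordered soliton graphs is open. -/
theorem SatisfiesSolitonEq.eventually_eq_of_contact {D : Set E2} (hD : IsOpen D)
    {lam₁ lam₂ : ℝ} (hle : lam₂ ≤ lam₁) {u₁ u₂ : E2 → ℝ}
    (h₁ : SatisfiesSolitonEq lam₁ D u₁) (h₂ : SatisfiesSolitonEq lam₂ D u₂)
    (hord : ∀ x ∈ D, u₁ x ≤ u₂ x) {x₀ : E2} (hx₀ : x₀ ∈ D) (htouch : u₁ x₀ = u₂ x₀) :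
    ∀ᶠ x in nhds x₀, u₁ x = u₂ x := by
  obtain ⟨ε, hε, hεD⟩ := Metric.isOpen_iff.1 hD x₀ hx₀
  refine Metric.eventually_nhds_iff.2 ⟨ε / 4, by positivity, fun y hy => ?_⟩
  by_contra hne
  have hKD : Metric.closedBall x₀ (ε / 2) ⊆ D :=
    (Metric.closedBall_subset_ball (by linarith)).trans hεD
  have hcompact : IsCompact {x ∈ Metric.closedBall x₀ (ε / 2) | u₁ x = u₂ x} := by
    refine (isCompact_closedBall x₀ (ε / 2)).of_isClosed_subset ?_ fun x hx => hx.1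
    have hc : ContinuousOn (fun x => u₁ x - u₂ x) (Metric.closedBall x₀ (ε / 2)) :=
      (h₁.1.continuousOn.sub h₂.1.continuousOn).mono hKD
    have := hc.preimage_isClosed_of_isClosed Metric.isClosed_closedBall
      (isClosed_singleton (x := (0 : ℝ)))
    simpa only [Set.preimage, Set.mem_singleton_iff, sub_eq_zero, Set.inter_def,
      Set.mem_ofPred_eq] using this
  obtain ⟨p, ⟨hpK, hp⟩, hmin⟩ := hcompact.exists_isMinOn
    ⟨x₀, Metric.mem_closedBall_self (by positivity), htouch⟩ (f := fun x => dist y x)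
    (by fun_prop)
  have hyp : dist y p ≤ dist y x₀ := hmin ⟨Metric.mem_closedBall_self (by positivity), htouch⟩
  have hpD : p ∈ D := hKD hpK
  have hpos : 0 < dist y p := dist_pos.2 fun h => hne (h ▸ hp)
  have hsubK : ∀ x ∈ Metric.ball y (dist y p), x ∈ Metric.closedBall x₀ (ε / 2) := fun x hx => by
    have := dist_triangle x y x₀
    rw [Metric.mem_ball] at hx
    rw [Metric.mem_closedBall]
    linarith
  have hins : insert p D = D := Set.insert_eq_of_mem hpD
  have hloc : IsLocalMin (fun x => u₂ x - u₁ x) p := by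
    filter_upwards [hD.mem_nhds hpD] with x hx
    linarith [hord x hx]
  have hdiff : ∀ {u : E2 → ℝ}, ContDiffOn ℝ 2 u D → DifferentiableAt ℝ u p := fun hu =>
    (hu.contDiffAt (hD.mem_nhds hpD)).differentiableAt two_ne_zero
  have hgrad : fderiv ℝ u₁ p = fderiv ℝ u₂ p := by
    have := hloc.fderiv_eq_zero
    rw [fderiv_fun_sub (hdiff h₂.1) (hdiff h₁.1), sub_eq_zero] at this
    exact this.symm
  refine boundary_point_of_contDiffOn_insert hD hpos rfl (fun x hx => hKD (hsubK x hx)) hle h₁ h₂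
    (hins.symm ▸ h₁.1.of_le one_le_two) (hins.symm ▸ h₂.1.of_le one_le_two)
    (fun x hx => (hord x (hKD (hsubK x hx))).lt_of_ne fun h => ?_) hp
    (by rw [hins, fderivWithin_of_isOpen hD hpD, fderivWithin_of_isOpen hD hpD, hgrad])
  have hxmin : dist y p ≤ dist y x := hmin ⟨hsubK x hx, h⟩
  rw [Metric.mem_ball, dist_comm] at hx
  exact hx.not_ge hxmin

/-- Boundary tangency principle for λ-translating solitons, graph form. -/
theorem boundary_tangency_principle
    (D : Set E2) (hD : D.Nonempty) (hDopen : IsOpen D) (hDconn : IsConnected D)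
    (p : E2) (hp : p ∈ frontier D)
    -- interior ball condition at p : an open ball contained in D with p on its boundary
    (hball : ∃ c : E2, ∃ r : ℝ, 0 < r ∧ Metric.ball c r ⊆ D ∧ p ∈ frontier (Metric.ball c r))
    (lam₁ lam₂ : ℝ) (hle : lam₂ ≤ lam₁)
    (u₁ u₂ : E2 → ℝ)
    (h₁ : SatisfiesSolitonEq lam₁ D u₁) (h₂ : SatisfiesSolitonEq lam₂ D u₂)
    -- both extend continuously differentiably to D ∪ {p}
    (hext₁ : ContDiffOn ℝ 1 u₁ (insert p D)) (hext₂ : ContDiffOn ℝ 1 u₂ (insert p D))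
    (hord : ∀ x ∈ D, u₁ x ≤ u₂ x)
    (htouch : u₁ p = u₂ p)
    (hgrad : fderivWithin ℝ u₁ (insert p D) p = fderivWithin ℝ u₂ (insert p D) p) :
    ∀ x ∈ D, u₁ x = u₂ x := by
  obtain ⟨c, r, hr, hsub, hpc⟩ := hball
  rw [frontier_ball _ hr.ne', Metric.mem_sphere, dist_comm] at hpc
  obtain ⟨x₀, hx₀, heq⟩ : ∃ x ∈ D, u₁ x = u₂ x := by
    by_contra! hne
    exact SatisfiesSolitonEq.boundary_point_of_contDiffOn_insert hDopen hr hpc hsub hle h₁ h₂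
      hext₁ hext₂ (fun x hx => (hord x (hsub hx)).lt_of_ne (hne x (hsub hx))) htouch hgrad
  have hcont : ContinuousOn (fun x => u₁ x - u₂ x) D := h₁.1.continuousOn.sub h₂.1.continuousOn
  have hopen : IsOpen (D ∩ (fun x => u₁ x - u₂ x) ⁻¹' {0}ᶜ) :=
    hcont.isOpen_inter_preimage hDopen isOpen_compl_singleton
  by_contra! hne
  obtain ⟨x₁, hx₁, hne₁⟩ := hne
  obtain ⟨z, hzD, hz, hz'⟩ := hDconn.isPreconnected (interior {x | u₁ x = u₂ x}) _ isOpen_interior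
    hopen
    (fun x hx => by
      by_cases h : u₁ x = u₂ x
      · exact Or.inl (mem_interior_iff_mem_nhds.2
          (h₁.eventually_eq_of_contact hDopen hle h₂ hord hx h))
      · exact Or.inr ⟨hx, sub_ne_zero.2 h⟩)
    ⟨x₀, hx₀, mem_interior_iff_mem_nhds.2
      (h₁.eventually_eq_of_contact hDopen hle h₂ hord hx₀ heq)⟩
    ⟨x₁, hx₁, hx₁, sub_ne_zero.2 hne₁⟩
  have hz₀ : z ∈ {x | u₁ x = u₂ x} := interior_subset hz
  exact hz'.2 (sub_eq_zero.2 hz₀)
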